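/- arXiv:1309.7404 — 2 statements merged into one kernel-verified Lean document; each statement's English description precedes it below -/
import Mathlib

section
/- Let J be a positive integer and b ∈ ℝ. If λ ∈ ℂ is an eigenvalue of L_J(b) and (b,λ) ∉ Z_J^{QES} (i.e., no eigenfunction for (b,λ) has the form p(z)·exp(z³/3 − b·z) with p a polynomial), then λ is real. -/
open Complex Filter Polynomial

/-- The quasi-exactly solvable candidate eigenfunction `p(z) exp(z³/3 - b z)`. -/
noncomputable def qesFun (b : ℂ) (p : Polynomial ℂ) : ℂ → ℂ :=
  fun z => p.eval z * Complex.exp (z ^ 3 / 3 - b * z)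

/-- `y` satisfies the quartic ODE `-y'' + (z⁴ - 2 b z² + 2 J z) y = λ y`. -/
def SatisfiesQuarticODE (J b lam : ℂ) (y : ℂ → ℂ) : Prop :=
  ∀ z : ℂ,
    -(deriv (deriv y) z) + (z ^ 4 - 2 * b * z ^ 2 + 2 * J * z) * y z = lam * y z

/-- `y` is an eigenfunction of `L_J(b)` with eigenvalue `λ`:
an entire function, not identically zero, satisfying the ODE and tending to `0`
along the rays `arg z = ±π/3`. -/
def IsQuarticEigenfunction (J b lam : ℂ) (y : ℂ → ℂ) : Prop :=
  Differentiable ℂ y ∧ y ≠ 0 ∧ SatisfiesQuarticODE J b lam y ∧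
  Tendsto (fun r : ℝ => y (r * Complex.exp (Complex.I * (Real.pi / 3))))
    atTop (nhds 0) ∧
  Tendsto (fun r : ℝ => y (r * Complex.exp (-Complex.I * (Real.pi / 3))))
    atTop (nhds 0)

/-- `λ` is an eigenvalue of `L_J(b)`. -/
def IsQuarticEigenvalue (J b lam : ℂ) : Prop :=
  ∃ y : ℂ → ℂ, IsQuarticEigenfunction J b lam y

/-- `p` witnesses that `(b, λ)` lies in the QES spectral locus of `L_J`. -/
def QESWitness (J b lam : ℂ) (p : Polynomial ℂ) : Prop :=
  p ≠ 0 ∧ SatisfiesQuarticODE J b lam (qesFun b p)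

/-- The quasi-exactly solvable part of the spectral locus of `L_J`. -/
def qesSpectralLocus (J : ℂ) : Set (ℂ × ℂ) :=
  {q : ℂ × ℂ | ∃ p : Polynomial ℂ, QESWitness J q.1 q.2 p}

/-- The real QES spectral locus of `L_J`. -/
def qesRealLocus (J : ℂ) : Set (ℝ × ℝ) :=
  {q : ℝ × ℝ | ((q.1 : ℂ), (q.2 : ℂ)) ∈ qesSpectralLocus J}

/-- `Γ_{n,m}`: points of the real QES spectral locus of `L_{n+1}` whose
polynomial has exactly `n - 2m` (distinct) real zeros. -/
def qesGamma (n m : ℕ) : Set (ℝ × ℝ) :=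
  {q : ℝ × ℝ | ∃ p : Polynomial ℂ, QESWitness ((n : ℂ) + 1) q.1 q.2 p ∧
    {z : ℂ | p.eval z = 0 ∧ z.im = 0}.ncard = n - 2 * m}


/-- Decay of order `n+2` in the closed right half plane. -/
def DecayRHP (n : ℕ) (K : ℝ) (k : ℂ → ℂ) : Prop :=
  ∀ z : ℂ, 0 ≤ z.re → ‖k z‖ ≤ K / (1 + ‖z‖) ^ (n + 2)

/-- The (unnormalised) inverse Laplace transform along `Re z = c`. -/
noncomputable def lapI (c : ℝ) (k : ℂ → ℂ) (t : ℝ) : ℂ :=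
  ∫ y : ℝ, Complex.exp (((c : ℂ) + y * I) * t) * k ((c : ℂ) + y * I)

lemma DecayRHP.nonneg {n : ℕ} {K : ℝ} {k : ℂ → ℂ} (h : DecayRHP n K k) : 0 ≤ K := by
  have := h 0 (by simp)
  simp at this
  exact (norm_nonneg _).trans this

lemma DecayRHP.bound {n : ℕ} {K : ℝ} {k : ℂ → ℂ} (h : DecayRHP n K k) (c : ℝ) (hc : 0 ≤ c)
    (y : ℝ) : ‖k ((c : ℂ) + y * I)‖ ≤ K * (1 + y ^ 2)⁻¹ := by
  have h1 := h ((c : ℂ) + y * I) (by simpa using hc)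
  refine h1.trans ?_
  rw [div_eq_mul_inv]
  have hK := h.nonneg
  have hy : |y| ≤ ‖(c : ℂ) + y * I‖ := by
    have := Complex.abs_im_le_norm ((c : ℂ) + y * I)
    simpa using this
  gcongr
  calc 1 + y ^ 2 = 1 + |y| ^ 2 := by rw [sq_abs]
    _ ≤ (1 + |y|) ^ 2 := by nlinarith [abs_nonneg y]
    _ ≤ (1 + ‖(c : ℂ) + y * I‖) ^ 2 := by gcongr
    _ ≤ (1 + ‖(c : ℂ) + y * I‖) ^ (n + 2) := by
        apply pow_le_pow_right₀ _ (by omega)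
        linarith [norm_nonneg ((c : ℂ) + y * I)]

lemma DecayRHP.bound' {n : ℕ} {K : ℝ} {k : ℂ → ℂ} (h : DecayRHP n K k) (c : ℝ) (hc : 0 < c)
    (y : ℝ) : ‖k ((c : ℂ) + y * I)‖ ≤ K * (c⁻¹) ^ (n + 2) * (1 + (y / c) ^ 2)⁻¹ := by
  have h1 := h ((c : ℂ) + y * I) (by simpa using hc.le)
  refine h1.trans ?_
  have hK := h.nonneg
  have hy : ‖(c : ℂ) + y * I‖ ^ 2 = c ^ 2 + y ^ 2 := by
    rw [← Complex.normSq_eq_norm_sq]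
    simp [Complex.normSq_apply]; ring
  have hcn : c ≤ ‖(c : ℂ) + y * I‖ := by
    have := Complex.re_le_norm ((c : ℂ) + y * I)
    simpa using this
  rw [div_eq_mul_inv, mul_assoc, inv_pow, ← mul_inv]
  gcongr
  calc c ^ (n + 2) * (1 + (y / c) ^ 2) = c ^ n * (c ^ 2 + y ^ 2) := by
        field_simp
        ring
    _ = c ^ n * ‖(c : ℂ) + y * I‖ ^ 2 := by rw [hy]
    _ ≤ ‖(c : ℂ) + y * I‖ ^ n * ‖(c : ℂ) + y * I‖ ^ 2 := by gcongr
    _ = ‖(c : ℂ) + y * I‖ ^ (n + 2) := by ring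
    _ ≤ _ := by gcongr; linarith

lemma norm_exp_line (c y t : ℝ) : ‖Complex.exp (((c : ℂ) + y * I) * t)‖ = Real.exp (c * t) := by
  rw [Complex.norm_exp]; simp

lemma lap_integrable {n : ℕ} {K : ℝ} {k : ℂ → ℂ} (h : DecayRHP n K k) (hk : Continuous k)
    (c : ℝ) (hc : 0 ≤ c) (t : ℝ) :
    MeasureTheory.Integrable (fun y : ℝ => Complex.exp (((c : ℂ) + y * I) * t) *
      k ((c : ℂ) + y * I)) := by
  refine MeasureTheory.Integrable.mono' (g := fun y => Real.exp (c * t) * (K * (1 + y ^ 2)⁻¹))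
    ((integrable_inv_one_add_sq.const_mul K).const_mul _) ?_ ?_
  · exact (by fun_prop : Continuous _).aestronglyMeasurable
  · refine Eventually.of_forall fun y => ?_
    rw [norm_mul, norm_exp_line]
    gcongr
    exact h.bound c hc y

lemma lap_bound {n : ℕ} {K : ℝ} {k : ℂ → ℂ} (h : DecayRHP n K k)
    (c : ℝ) (hc : 0 < c) (t : ℝ) :
    ‖lapI c k t‖ ≤ Real.exp (c * t) * (K * (c⁻¹) ^ (n + 1) * Real.pi) := by
  have hIntg : MeasureTheory.Integrable (fun y : ℝ => (1 + (y / c) ^ 2)⁻¹) :=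
    integrable_inv_one_add_sq.comp_div hc.ne'
  have := MeasureTheory.norm_integral_le_of_norm_le (μ := MeasureTheory.volume)
    (f := fun y : ℝ => Complex.exp (((c : ℂ) + y * I) * t) * k ((c : ℂ) + y * I))
    (g := fun y => Real.exp (c * t) * (K * (c⁻¹) ^ (n + 2) * (1 + (y / c) ^ 2)⁻¹))
    ((hIntg.const_mul _).const_mul _)
    (Eventually.of_forall fun y => by
      rw [norm_mul, norm_exp_line]
      gcongr
      exact h.bound' c hc y)
  refine this.trans (le_of_eq ?_)
  rw [MeasureTheory.integral_const_mul, MeasureTheory.integral_const_mul]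
  have h2 := MeasureTheory.Measure.integral_comp_div (fun x : ℝ => (1 + x ^ 2)⁻¹) c
  rw [h2, integral_univ_inv_one_add_sq, abs_of_pos hc, smul_eq_mul]
  rw [pow_succ c⁻¹ (n + 1)]
  field_simp

lemma lap_bound0 {n : ℕ} {K : ℝ} {k : ℂ → ℂ} (h : DecayRHP n K k) (t : ℝ) :
    ‖lapI 0 k t‖ ≤ K * Real.pi := by
  have := MeasureTheory.norm_integral_le_of_norm_le (μ := MeasureTheory.volume)
    (f := fun y : ℝ => Complex.exp ((((0:ℝ) : ℂ) + y * I) * t) * k (((0:ℝ) : ℂ) + y * I))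
    (g := fun y => K * (1 + y ^ 2)⁻¹)
    (integrable_inv_one_add_sq.const_mul _)
    (Eventually.of_forall fun y => by
      rw [norm_mul, norm_exp_line]
      simpa using h.bound 0 le_rfl y)
  refine this.trans (le_of_eq ?_)
  rw [MeasureTheory.integral_const_mul, integral_univ_inv_one_add_sq]

/-- Contour shift. -/
lemma lap_shift {n : ℕ} {K : ℝ} {k : ℂ → ℂ} (h : DecayRHP n K k) (hk : Differentiable ℂ k)
    (c : ℝ) (hc : 0 ≤ c) (t : ℝ) : lapI 0 k t = lapI c k t := by
  set f : ℂ → ℂ := fun z => Complex.exp (z * t) * k z with hf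
  have hfd : Differentiable ℂ f := by fun_prop
  have hrect : ∀ T : ℝ, (∫ y in (-T)..T, f ((c : ℂ) + y * I)) - (∫ y in (-T)..T, f (((0:ℝ) : ℂ) + y * I))
      = I * ((∫ x in (0:ℝ)..c, f (x + ((-T : ℝ) : ℂ) * I)) - ∫ x in (0:ℝ)..c, f (x + (T : ℂ) * I)) := by
    intro T
    have := Complex.integral_boundary_rect_eq_zero_of_differentiableOn f
      (⟨0, -T⟩ : ℂ) (⟨c, T⟩ : ℂ) hfd.differentiableOn
    simp only [smul_eq_mul] at this
    linear_combination (-I) * this + ((∫ y in (-T)..T, f ((c : ℂ) + y * I)) - (∫ y in (-T)..T, f (((0:ℝ) : ℂ) + y * I))) * I_mul_I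
  have hedge : ∀ T : ℝ, ∀ S : ℝ, |S| = |T| → ‖∫ x in (0:ℝ)..c, f (x + (S : ℂ) * I)‖ ≤
      Real.exp (c * |t|) * (K * (1 + T ^ 2)⁻¹) * |c - 0| := by
    intro T S hS
    apply intervalIntegral.norm_integral_le_of_norm_le_const
    intro x hx
    rw [Set.uIoc_of_le hc] at hx
    simp only [hf]
    rw [norm_mul, norm_exp_line, ← sq_abs T, ← hS, sq_abs]
    have hK := h.nonneg
    have h1 : x * t ≤ c * |t| :=
      (mul_le_mul_of_nonneg_left (le_abs_self t) hx.1.le).trans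
        (mul_le_mul_of_nonneg_right hx.2 (abs_nonneg t))
    have h2 := h.bound x hx.1.le S
    exact mul_le_mul (Real.exp_le_exp.mpr h1) h2 (norm_nonneg _) (Real.exp_pos _).le
  have hl1 := MeasureTheory.intervalIntegral_tendsto_integral (lap_integrable h hk.continuous c hc t)
    tendsto_neg_atTop_atBot tendsto_id
  have hl2 := MeasureTheory.intervalIntegral_tendsto_integral
    (lap_integrable h hk.continuous 0 le_rfl t)
    tendsto_neg_atTop_atBot tendsto_id
  have hl := hl1.sub hl2
  have hz : Tendsto (fun T : ℝ => (∫ y in (-T)..T, f ((c : ℂ) + y * I)) -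
      (∫ y in (-T)..T, f (((0:ℝ) : ℂ) + y * I))) atTop (nhds 0) := by
    have hb : Tendsto (fun T : ℝ => 2 * (Real.exp (c * |t|) * (K * (1 + T ^ 2)⁻¹) * |c - 0|))
        atTop (nhds 0) := by
      have h1 : Tendsto (fun T : ℝ => (1 + T ^ 2)⁻¹) atTop (nhds 0) := by
        apply Tendsto.inv_tendsto_atTop
        apply tendsto_atTop_add_const_left
        exact tendsto_pow_atTop (by norm_num)
      have := (((h1.const_mul K).const_mul (Real.exp (c * |t|))).mul_const |c - 0|).const_mul 2
      simpa using this
    refine squeeze_zero_norm (fun T => ?_) hb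
    rw [hrect T, norm_mul, Complex.norm_I, one_mul]
    refine (norm_sub_le _ _).trans ?_
    rw [two_mul]
    exact add_le_add (hedge T (-T) (abs_neg T)) (hedge T T rfl)
  have := tendsto_nhds_unique hl hz
  exact (sub_eq_zero.mp this).symm

lemma lap_zero_of_nonpos {n : ℕ} {K : ℝ} {k : ℂ → ℂ} (h : DecayRHP n K k)
    (hk : Differentiable ℂ k) (t : ℝ) (ht : t ≤ 0) : lapI 0 k t = 0 := by
  have hb : Tendsto (fun c : ℝ => 1 * (K * (c⁻¹) ^ (n + 1) * Real.pi)) atTop (nhds 0) := by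
    have h1 : Tendsto (fun c : ℝ => (c⁻¹) ^ (n + 1)) atTop (nhds 0) := by
      have := (tendsto_inv_atTop_zero (𝕜 := ℝ)).pow (n + 1)
      simpa using this
    simpa using ((h1.const_mul K).mul_const Real.pi).const_mul 1
  have : Tendsto (fun _ : ℝ => lapI 0 k t) atTop (nhds 0) := by
    refine squeeze_zero_norm' ?_ hb
    filter_upwards [eventually_gt_atTop 0] with c hc
    rw [lap_shift h hk c hc.le t]
    refine (lap_bound h c hc t).trans ?_
    have hK := h.nonneg
    gcongr
    rw [Real.exp_le_one_iff]
    exact mul_nonpos_of_nonneg_of_nonpos hc.le ht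
  exact tendsto_nhds_unique tendsto_const_nhds this

lemma lap_small {n : ℕ} {K : ℝ} {k : ℂ → ℂ} (h : DecayRHP n K k)
    (hk : Differentiable ℂ k) (t : ℝ) (ht : 0 < t) :
    ‖lapI 0 k t‖ ≤ Real.exp 1 * K * Real.pi * t ^ (n + 1) := by
  rw [lap_shift h hk t⁻¹ (by positivity) t]
  refine (lap_bound h t⁻¹ (by positivity) t).trans (le_of_eq ?_)
  rw [inv_mul_cancel₀ ht.ne', inv_inv]; ring

/-- Differentiation under the integral sign. -/
lemma lap_deriv {n : ℕ} {K K' : ℝ} {k : ℂ → ℂ} (h : DecayRHP n K k) (hk : Continuous k)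
    (h' : DecayRHP n K' (fun z => z * k z)) (t : ℝ) :
    HasDerivAt (lapI 0 k) (lapI 0 (fun z => z * k z) t) t := by
  refine (hasDerivAt_integral_of_dominated_loc_of_deriv_le
    (F := fun (t : ℝ) (y : ℝ) => Complex.exp ((((0:ℝ) : ℂ) + y * I) * t) * k (((0:ℝ) : ℂ) + y * I))
    (F' := fun (t : ℝ) (y : ℝ) => Complex.exp ((((0:ℝ) : ℂ) + y * I) * t) *
      ((((0:ℝ) : ℂ) + y * I) * k (((0:ℝ) : ℂ) + y * I)))
    (bound := fun y => K' * (1 + y ^ 2)⁻¹) (s := Set.univ) univ_mem ?_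
    (lap_integrable h hk 0 le_rfl t) ?_ ?_ ?_ ?_).2
  · exact Eventually.of_forall fun x => (lap_integrable h hk 0 le_rfl x).aestronglyMeasurable
  · exact (lap_integrable h' (by fun_prop) 0 le_rfl t).aestronglyMeasurable
  · refine Eventually.of_forall fun y x _ => ?_
    rw [norm_mul, norm_exp_line]
    simpa using h'.bound 0 le_rfl y
  · exact integrable_inv_one_add_sq.const_mul _
  · refine Eventually.of_forall fun y x _ => ?_
    have h1 : HasDerivAt (fun x : ℝ => (((0:ℝ) : ℂ) + y * I) * (x : ℂ)) (((0:ℝ) : ℂ) + y * I) x := by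
      simpa using (HasDerivAt.ofReal_comp (hasDerivAt_id x)).const_mul (((0:ℝ) : ℂ) + y * I)
    exact (h1.cexp.mul_const (k (((0:ℝ) : ℂ) + y * I))).congr_deriv (by ring)

/-- Integration by parts. -/
lemma lap_parts {n : ℕ} {K K' : ℝ} {k : ℂ → ℂ} (h : DecayRHP n K k) (hk : Differentiable ℂ k)
    (h' : DecayRHP n K' (deriv k)) (t : ℝ) :
    lapI 0 (deriv k) t = - t * lapI 0 k t := by
  have hk' : Differentiable ℂ (deriv k) := fun z =>
    (hk.analyticAt z).deriv.differentiableAt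
  have hd : ∀ y : ℝ, HasDerivAt
      (fun y : ℝ => Complex.exp ((((0:ℝ) : ℂ) + y * I) * t) * k (((0:ℝ) : ℂ) + y * I))
      (I * t * (Complex.exp ((((0:ℝ) : ℂ) + y * I) * t) * k (((0:ℝ) : ℂ) + y * I)) +
        I * (Complex.exp ((((0:ℝ) : ℂ) + y * I) * t) * deriv k (((0:ℝ) : ℂ) + y * I))) y := by
    intro y
    have h1 : HasDerivAt (fun x : ℝ => (((0:ℝ) : ℂ) + x * I)) I y := by
      simpa using ((HasDerivAt.ofReal_comp (hasDerivAt_id y)).mul_const I).const_add (((0:ℝ) : ℂ))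
    have h2 := (h1.mul_const (t : ℂ)).cexp
    have h3 := (hk (((0:ℝ) : ℂ) + y * I)).hasDerivAt.comp y h1
    exact (h2.mul h3).congr_deriv (by simp only [Function.comp_apply]; ring)
  have hi1 := lap_integrable h hk.continuous 0 le_rfl t
  have hi2 := lap_integrable h' hk'.continuous 0 le_rfl t
  have hlim : Tendsto (fun y : ℝ => K * (1 + y ^ 2)⁻¹) (cocompact ℝ) (nhds 0) := by
    have h1 : Tendsto (fun y : ℝ => (1 + y ^ 2)⁻¹) (cocompact ℝ) (nhds 0) := by
      apply Tendsto.inv_tendsto_atTop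
      apply tendsto_atTop_add_const_left
      have : Tendsto (fun y : ℝ => ‖y‖ ^ 2) (cocompact ℝ) atTop :=
        (tendsto_pow_atTop (by norm_num)).comp (tendsto_norm_cocompact_atTop)
      simpa using this
    simpa using h1.const_mul K
  have hl : Tendsto (fun y : ℝ => Complex.exp ((((0:ℝ) : ℂ) + y * I) * t) * k (((0:ℝ) : ℂ) + y * I))
      (cocompact ℝ) (nhds 0) := by
    refine squeeze_zero_norm (fun y => ?_) hlim
    rw [norm_mul, norm_exp_line]
    simpa using h.bound 0 le_rfl y
  have := MeasureTheory.integral_of_hasDerivAt_of_tendsto hd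
    ((hi1.const_mul _).add (hi2.const_mul _)) (hl.mono_left atBot_le_cocompact)
    (hl.mono_left atTop_le_cocompact)
  rw [MeasureTheory.integral_add (hi1.const_mul _) (hi2.const_mul _),
    MeasureTheory.integral_const_mul, MeasureTheory.integral_const_mul] at this
  change I * t * lapI 0 k t + I * lapI 0 (deriv k) t = 0 - 0 at this
  linear_combination (-I) * this + (t * lapI 0 k t + lapI 0 (deriv k) t) * I_mul_I

/-- Injectivity. -/
lemma lap_inj {n : ℕ} {K : ℝ} {k : ℂ → ℂ} (h : DecayRHP n K k) (hk : Differentiable ℂ k)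
    (h0 : ∀ t : ℝ, lapI 0 k t = 0) : ∀ z, k z = 0 := by
  set f : ℝ → ℂ := fun y => k (((0:ℝ) : ℂ) + y * I) with hf
  have hfc : Continuous f := by
    have := hk.continuous
    fun_prop
  have hfi : MeasureTheory.Integrable f := by
    have := lap_integrable h hk.continuous 0 le_rfl 0
    simpa [hf] using this
  have hF : FourierTransform.fourier f = 0 := by
    ext w
    rw [Real.fourier_eq']
    have := h0 (-2 * Real.pi * w)
    simp only [Pi.zero_apply]
    rw [← this, lapI]
    congr 1
    ext y
    simp only [hf, smul_eq_mul]
    congr 2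
    simp
    ring
  have h2 := hfc.fourierInv_fourier_eq hfi (by rw [hF]; exact MeasureTheory.integrable_zero _ _ _)
  rw [hF] at h2
  have hf0 : ∀ y : ℝ, f y = 0 := by
    intro y
    rw [← h2, Real.fourierInv_eq]
    simp
  have hA : AnalyticOnNhd ℂ k Set.univ := fun z _ => hk.analyticAt z
  have := hA.eqOn_zero_of_preconnected_of_frequently_eq_zero (z₀ := 0) isPreconnected_univ
    (Set.mem_univ _) ?_
  · intro z; exact this (Set.mem_univ z)
  · have ht : Tendsto (fun y : ℝ => (y : ℂ) * I) (nhdsWithin 0 {0}ᶜ) (nhdsWithin 0 {0}ᶜ) := by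
      apply tendsto_nhdsWithin_of_tendsto_nhds_of_eventually_within
      · have : ContinuousAt (fun y : ℝ => (y : ℂ) * I) 0 := by fun_prop
        have h3 := this.tendsto
        simp only [ofReal_zero, zero_mul] at h3
        exact h3.mono_left nhdsWithin_le_nhds
      · filter_upwards [self_mem_nhdsWithin] with y hy
        simpa using hy
    refine ht.frequently (Eventually.frequently (Eventually.of_forall fun y => ?_))
    simpa [hf] using hf0 y


lemma lap_lin {n : ℕ} {K K' : ℝ} {k k' : ℂ → ℂ} (h : DecayRHP n K k) (hk : Continuous k)
    (h' : DecayRHP n K' k') (hk' : Continuous k') (α β : ℂ) (t : ℝ) :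
    lapI 0 (fun z => α * k z + β * k' z) t = α * lapI 0 k t + β * lapI 0 k' t := by
  unfold lapI
  rw [← MeasureTheory.integral_const_mul, ← MeasureTheory.integral_const_mul,
    ← MeasureTheory.integral_add ((lap_integrable h hk 0 le_rfl t).const_mul _)
      ((lap_integrable h' hk' 0 le_rfl t).const_mul _)]
  congr 1
  ext y
  ring

lemma DecayRHP.lin {n : ℕ} {K K' : ℝ} {k k' : ℂ → ℂ} (h : DecayRHP n K k)
    (h' : DecayRHP n K' k') (α β : ℂ) :
    DecayRHP n (‖α‖ * K + ‖β‖ * K') (fun z => α * k z + β * k' z) := by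
  intro z hz
  have h1 := h z hz
  have h2 := h' z hz
  calc ‖α * k z + β * k' z‖ ≤ ‖α‖ * ‖k z‖ + ‖β‖ * ‖k' z‖ := by
        refine (norm_add_le _ _).trans ?_
        rw [norm_mul, norm_mul]
    _ ≤ ‖α‖ * (K / (1 + ‖z‖) ^ (n + 2)) + ‖β‖ * (K' / (1 + ‖z‖) ^ (n + 2)) := by gcongr
    _ = _ := by ring

/-- The half-line Sturm-Liouville argument. -/
lemma sturm_liouville (n : ℕ) (b : ℝ) (μ : ℂ) (hμ : μ.im ≠ 0) (φ χ : ℝ → ℂ) (C : ℝ)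
    (hφ : ∀ t > (0:ℝ), HasDerivAt φ ((2 * ((n : ℂ) + 1) * φ t - χ t) / (2 * t)) t)
    (hχ : ∀ t > (0:ℝ), HasDerivAt χ (-((t : ℂ) ^ 2 + 2 * b * t + μ) * φ t) t)
    (b1 : ∀ t > 0, ‖φ t‖ ≤ C) (b2 : ∀ t > 0, ‖χ t‖ ≤ C)
    (s1 : ∀ t > 0, ‖φ t‖ ≤ C * t ^ (n + 1)) (s2 : ∀ t > 0, ‖χ t‖ ≤ C * t ^ (n + 1)) :
    ∀ t > 0, φ t = 0 := by
  set H : ℝ → ℝ := fun t => -μ.im * ((t ^ (n + 1))⁻¹ * (χ t * (starRingEnd ℂ) (φ t)).im) with hH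
  have hC : 0 ≤ C := (norm_nonneg _).trans (b1 1 one_pos)
  have hder : ∀ t > 0, HasDerivAt H (μ.im ^ 2 * (t ^ (n + 1))⁻¹ * ‖φ t‖ ^ 2) t := by
    intro t ht
    have h1 := (hχ t ht).mul ((hφ t ht).star)
    have h2 := Complex.imCLM.hasFDerivAt.comp_hasDerivAt t h1
    have h3 := (hasDerivAt_pow (n + 1) t).inv (pow_ne_zero _ ht.ne')
    have h4 := (h3.mul h2).const_mul (-μ.im)
    refine h4.congr_deriv ?_
    simp only [Function.comp_apply, Complex.imCLM_apply, Complex.star_def, Pi.mul_apply, Pi.inv_apply]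
    have hφn : ‖φ t‖ ^ 2 = (φ t).re ^ 2 + (φ t).im ^ 2 := by
      rw [← Complex.normSq_eq_norm_sq, Complex.normSq_apply]; ring
    have hdiv : (2 * ((n : ℂ) + 1) * φ t - χ t) / (2 * t) =
        ((2 * t)⁻¹ : ℝ) * (2 * ((n : ℂ) + 1) * φ t - χ t) := by
      push_cast
      rw [div_eq_inv_mul]
    rw [hdiv, hφn]
    have hcast : ((n : ℂ) + 1) = (((n : ℝ) + 1 : ℝ) : ℂ) := by push_cast; ring
    have hcast2 : ((t : ℂ) ^ 2 + 2 * b * t + μ) = ((t ^ 2 + 2 * b * t : ℝ) : ℂ) + μ := by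
      push_cast; ring
    rw [hcast, hcast2]
    have e2 : (2 : ℂ) = ((2 : ℝ) : ℂ) := by norm_num
    rw [e2]
    simp only [map_mul, map_sub, Complex.conj_ofReal, Complex.add_im, Complex.mul_im, Complex.mul_re,
      Complex.add_re, Complex.sub_re, Complex.sub_im, Complex.conj_re, Complex.conj_im,
      Complex.neg_re, Complex.neg_im, Complex.ofReal_re, Complex.ofReal_im]
    push_cast

    field_simp
    ring
  have hnorm : ∀ t > 0, ‖H t‖ ≤ |μ.im| * ((t ^ (n + 1))⁻¹ * (‖χ t‖ * ‖φ t‖)) := by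
    intro t ht
    simp only [hH, norm_mul, norm_neg, norm_inv, norm_pow, Real.norm_eq_abs, abs_of_pos ht]
    gcongr
    refine (Complex.abs_im_le_norm _).trans ?_
    simp
  have hinf : Tendsto H atTop (nhds 0) := by
    have hb : Tendsto (fun t : ℝ => |μ.im| * ((t ^ (n + 1))⁻¹ * (C * C))) atTop (nhds 0) := by
      have h1 : Tendsto (fun t : ℝ => (t ^ (n + 1))⁻¹) atTop (nhds 0) :=
        (tendsto_pow_atTop (by omega)).inv_tendsto_atTop
      simpa using (h1.mul_const (C * C)).const_mul |μ.im|
    refine squeeze_zero_norm' ?_ hb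
    filter_upwards [eventually_gt_atTop 0] with t ht
    refine (hnorm t ht).trans ?_
    gcongr
    · exact b2 t ht
    · exact b1 t ht
  have hzero : Tendsto H (nhdsWithin 0 (Set.Ioi 0)) (nhds 0) := by
    have hb : Tendsto (fun t : ℝ => |μ.im| * (C * C * t ^ (n + 1))) (nhdsWithin 0 (Set.Ioi 0)) (nhds 0) := by
      have h1 : ContinuousAt (fun t : ℝ => |μ.im| * (C * C * t ^ (n + 1))) 0 := by fun_prop
      have h2 := h1.tendsto
      simp at h2
      refine Tendsto.mono_left ?_ nhdsWithin_le_nhds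
      simpa using h2
    refine squeeze_zero_norm' ?_ hb
    filter_upwards [self_mem_nhdsWithin] with t ht
    refine (hnorm t ht).trans ?_
    have ht' : 0 < t := ht
    calc |μ.im| * ((t ^ (n + 1))⁻¹ * (‖χ t‖ * ‖φ t‖))
        ≤ |μ.im| * ((t ^ (n + 1))⁻¹ * ((C * t ^ (n + 1)) * (C * t ^ (n + 1)))) := by
          gcongr
          · exact s2 t ht
          · exact s1 t ht
      _ = |μ.im| * (C * C * t ^ (n + 1)) := by field_simp
  have hmono : MonotoneOn H (Set.Ioi 0) := by
    apply monotoneOn_of_deriv_nonneg (convex_Ioi 0)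
    · exact fun t ht => (hder t ht).continuousAt.continuousWithinAt
    · intro t ht
      rw [interior_Ioi] at ht
      exact (hder t ht).differentiableAt.differentiableWithinAt
    · intro t ht
      rw [interior_Ioi] at ht
      rw [(hder t ht).deriv]
      have : 0 < t := ht
      positivity
  have hH0 : ∀ t > 0, H t = 0 := by
    intro t ht
    apply le_antisymm
    · refine ge_of_tendsto hinf ?_
      filter_upwards [eventually_ge_atTop t] with s hs
      exact hmono ht (lt_of_lt_of_le ht hs) hs
    · refine le_of_tendsto hzero ?_
      filter_upwards [Ioo_mem_nhdsGT ht] with s hs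
      exact hmono hs.1 ht hs.2.le
  intro t ht
  have h1 : HasDerivAt H 0 t := by
    refine (hasDerivAt_const t (0:ℝ)).congr_of_eventuallyEq ?_
    filter_upwards [Ioi_mem_nhds ht] with s hs
    exact hH0 s hs
  have h2 := (hder t ht).unique h1
  have : 0 < t ^ (n + 1) := by positivity
  have h3 : ‖φ t‖ ^ 2 = 0 := by
    rcases mul_eq_zero.mp h2 with h | h
    · exfalso
      rcases mul_eq_zero.mp h with h | h
      · exact hμ (by simpa using h)
      · exact (inv_ne_zero this.ne') h
    · exact h
  simpa using h3

lemma final_argument (n : ℕ) (b : ℝ) (μ : ℂ) (hμ : μ.im ≠ 0) (v : ℂ → ℂ) (hv : Differentiable ℂ v)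
    (hode : ∀ z, deriv (deriv v) z + 2 * (z ^ 2 - b) * deriv v z +
      (2 * ((n : ℂ) + 2) * z + μ) * v z = 0) (K : ℝ)
    (h0 : ∀ z : ℂ, 0 ≤ z.re → ‖v z‖ ≤ K / (1 + ‖z‖) ^ (n + 2))
    (h1 : ∀ z : ℂ, 0 ≤ z.re → ‖deriv v z‖ ≤ K / (1 + ‖z‖) ^ (n + 3))
    (h2 : ∀ z : ℂ, 0 ≤ z.re → ‖deriv (deriv v) z‖ ≤ K / (1 + ‖z‖) ^ (n + 2)) :
    ∀ z, v z = 0 := by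
  have hv1 : Differentiable ℂ (deriv v) := fun z => (hv.analyticAt z).deriv.differentiableAt
  have hv2 : Differentiable ℂ (deriv (deriv v)) := fun z => (hv1.analyticAt z).deriv.differentiableAt
  have hK : 0 ≤ K := DecayRHP.nonneg (n := n) h0
  have d0 : DecayRHP n K v := h0
  have d2 : DecayRHP n K (deriv (deriv v)) := h2
  have d1 : DecayRHP n K (deriv v) := by
    intro z hz
    refine (h1 z hz).trans ?_
    gcongr
    · linarith [norm_nonneg z]
    · omega
  have d3 : DecayRHP n K (fun z => z * deriv v z) := by
    intro z hz
    rw [norm_mul]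
    calc ‖z‖ * ‖deriv v z‖ ≤ (1 + ‖z‖) * (K / (1 + ‖z‖) ^ (n + 3)) := by
          gcongr
          · linarith
          · exact h1 z hz
      _ = K / (1 + ‖z‖) ^ (n + 2) := by
          have : 0 < 1 + ‖z‖ := by positivity
          rw [pow_succ (1 + ‖z‖) (n + 2)]
          field_simp
  set k : ℂ → ℂ := fun z => 2 * (z * deriv v z) + (2 * ((n : ℂ) + 2)) * v z with hk
  have dk := d3.lin d0 2 (2 * ((n : ℂ) + 2))
  have hkd : Differentiable ℂ k := by fun_prop
  have hzk : (fun z => z * k z) = fun z => (-1) * deriv (deriv v) z + 1 *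
      ((2 * (b : ℂ)) * deriv v z + (-μ) * v z) := by
    ext z
    simp only [hk]
    linear_combination hode z
  have dl := d1.lin d0 (2 * (b : ℂ)) (-μ)
  have hlc : Continuous (fun z => (2 * (b : ℂ)) * deriv v z + (-μ) * v z) := by
    have := hv.continuous; have := hv1.continuous; fun_prop
  have dzk := d2.lin dl (-1) 1
  rw [← hzk] at dzk
  have hzv : Continuous (fun z => z * deriv v z) := by
    have := hv1.continuous; fun_prop
  -- the formulas
  have e1 : ∀ t : ℝ, lapI 0 (deriv v) t = -t * lapI 0 v t := lap_parts d0 hv d1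
  have e2 : ∀ t : ℝ, lapI 0 (deriv (deriv v)) t = t ^ 2 * lapI 0 v t := by
    intro t
    rw [lap_parts d1 hv1 d2, e1]; ring
  have e3 : ∀ t : ℝ, lapI 0 k t = 2 * lapI 0 (fun z => z * deriv v z) t +
      (2 * ((n : ℂ) + 2)) * lapI 0 v t := fun t => lap_lin d3 hzv d0 hv.continuous _ _ t
  have e4 : ∀ t : ℝ, lapI 0 (fun z => z * k z) t = -((t : ℂ) ^ 2 + 2 * b * t + μ) * lapI 0 v t := by
    intro t
    rw [hzk, lap_lin d2 hv2.continuous dl hlc, lap_lin d1 hv1.continuous d0 hv.continuous, e1, e2]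
    ring
  have hχ : ∀ t > (0:ℝ), HasDerivAt (lapI 0 k) (-((t : ℂ) ^ 2 + 2 * b * t + μ) * lapI 0 v t) t := by
    intro t _
    rw [← e4]
    exact lap_deriv dk hkd.continuous dzk t
  have hφ : ∀ t > (0:ℝ), HasDerivAt (lapI 0 v)
      ((2 * ((n : ℂ) + 1) * lapI 0 v t - lapI 0 k t) / (2 * t)) t := by
    intro t ht
    have ht' : (t : ℂ) ≠ 0 := by exact_mod_cast ht.ne'
    have a1 := lap_deriv d1 hv1.continuous d3 t
    have a2 : HasDerivAt (fun s : ℝ => (s : ℂ)) 1 t := (hasDerivAt_id t).ofReal_comp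
    have a3 := (a1.div a2 ht').neg
    have a4 : HasDerivAt (lapI 0 v) _ t := a3.congr_of_eventuallyEq (by
      filter_upwards [Ioi_mem_nhds ht] with s hs
      have hs' : (s : ℂ) ≠ 0 := by exact_mod_cast (ne_of_gt hs)
      simp only [Pi.neg_apply, Pi.div_apply]
      rw [e1]
      field_simp)
    refine a4.congr_deriv ?_
    rw [e1, e3]
    field_simp
    ring
  set M : ℝ := ‖(2:ℂ)‖ * K + ‖2 * ((n : ℂ) + 2)‖ * K + K with hM
  have hKM : K ≤ M := by rw [hM]; have : 0 ≤ ‖(2:ℂ)‖ * K + ‖2 * ((n : ℂ) + 2)‖ * K := by positivity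
                         linarith
  have hkM : ‖(2:ℂ)‖ * K + ‖2 * ((n : ℂ) + 2)‖ * K ≤ M := by rw [hM]; linarith
  have hpi := Real.pi_pos
  have hexp : 1 ≤ Real.exp 1 := Real.one_le_exp (by norm_num)
  have hM0 : 0 ≤ M := hK.trans hKM
  have hMM : M * Real.pi ≤ Real.exp 1 * M * Real.pi := by
    have : 0 ≤ M * Real.pi := by positivity
    nlinarith
  have hpos := sturm_liouville n b μ hμ (lapI 0 v) (lapI 0 k) (Real.exp 1 * M * Real.pi) hφ hχ
    (fun t _ => (lap_bound0 d0 t).trans (le_trans (by gcongr) hMM))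
    (fun t _ => (lap_bound0 dk t).trans (le_trans (by gcongr) hMM))
    (fun t ht => (lap_small d0 hv t ht).trans (by gcongr))
    (fun t ht => (lap_small dk hkd t ht).trans (by gcongr))
  refine lap_inj d0 hv fun t => ?_
  rcases le_or_gt t 0 with ht | ht
  · exact lap_zero_of_nonpos d0 hv t ht
  · exact hpos t ht


/-- Non-growing solutions of the first order system on the ray are bounded. -/
lemma ray_system (s p α γ : ℝ → ℂ) (ω : ℂ) (hω : ‖ω‖ = 1) (R0 C : ℝ) (hC : 0 ≤ C)
    (hs : ∀ r ≥ R0, HasDerivAt s (ω * p r) r)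
    (hp : ∀ r ≥ R0, HasDerivAt p (α r * p r + γ r * s r) r)
    (hα : ∀ r ≥ R0, 19 / 10 * r ^ 2 ≤ (α r).re)
    (hγ : ∀ r ≥ R0, ‖γ r‖ ≤ C)
    (hgrow : Tendsto (fun r : ℝ => r ^ 4 * ‖p r‖ ^ 2 * Real.exp (-r ^ 3)) atTop (nhds 0)) :
    ∃ R K : ℝ, ∀ r ≥ R, ‖s r‖ ≤ K ∧ r ^ 2 * ‖p r‖ ≤ K := by
  set K : ℝ := C ^ 2 + 1 with hK
  have hK1 : 1 ≤ K := by nlinarith [sq_nonneg C]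
  have hK0 : 0 ≤ K := by linarith
  set R : ℝ := max R0 (max 1 K) with hR
  have hRR0 : R0 ≤ R := le_max_left _ _
  have hR1 : 1 ≤ R := (le_max_left _ _).trans (le_max_right _ _)
  have hRK : K ≤ R := (le_max_right _ _).trans (le_max_right _ _)
  have hn : ∀ r ≥ R, HasDerivAt (fun r => ‖s r‖ ^ 2) (2 * inner ℝ (s r) (ω * p r)) r :=
    fun r hr => (hs r (hRR0.trans hr)).norm_sq
  have hQ : ∀ r ≥ R, HasDerivAt (fun r => ‖p r‖ ^ 2)
      (2 * inner ℝ (p r) (α r * p r + γ r * s r)) r :=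
    fun r hr => (hp r (hRR0.trans hr)).norm_sq
  have hn_le : ∀ r, inner ℝ (s r) (ω * p r) ≤ ‖s r‖ * ‖p r‖ := by
    intro r
    have := real_inner_le_norm (s r) (ω * p r)
    rwa [norm_mul, hω, one_mul] at this
  have hQ_ge : ∀ r ≥ R, 19 / 10 * r ^ 2 * ‖p r‖ ^ 2 - C * (‖p r‖ * ‖s r‖) ≤
      inner ℝ (p r) (α r * p r + γ r * s r) := by
    intro r hr
    rw [inner_add_right]
    have h1 : inner ℝ (p r) (α r * p r) = (α r).re * ‖p r‖ ^ 2 := by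
      rw [Complex.inner, ← Complex.normSq_eq_norm_sq, Complex.normSq_apply]
      simp
      ring
    have h2 : -(‖p r‖ * ‖γ r * s r‖) ≤ inner ℝ (p r) (γ r * s r) :=
      (abs_le.mp (abs_real_inner_le_norm (p r) (γ r * s r))).1
    rw [norm_mul] at h2
    have h3 : ‖γ r‖ * (‖p r‖ * ‖s r‖) ≤ C * (‖p r‖ * ‖s r‖) := by
      gcongr; exact hγ r (hRR0.trans hr)
    have h4 : 19 / 10 * r ^ 2 * ‖p r‖ ^ 2 ≤ (α r).re * ‖p r‖ ^ 2 := by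
      gcongr; exact hα r (hRR0.trans hr)
    rw [h1]
    nlinarith
  -- the cone function
  set Ψ : ℝ → ℝ := fun r => (r ^ 4 * ‖p r‖ ^ 2 - K * ‖s r‖ ^ 2) * Real.exp (-r ^ 3) with hΨ
  have hΨd : ∀ r ≥ R, HasDerivAt Ψ
      (((4 * r ^ 3 * ‖p r‖ ^ 2 + r ^ 4 * (2 * inner ℝ (p r) (α r * p r + γ r * s r)))
        - K * (2 * inner ℝ (s r) (ω * p r))) * Real.exp (-r ^ 3) +
        (r ^ 4 * ‖p r‖ ^ 2 - K * ‖s r‖ ^ 2) * (Real.exp (-r ^ 3) * (-(3 * r ^ 2)))) r := by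
    intro r hr
    have h1 := hasDerivAt_pow 4 r
    have h2 := (h1.mul (hQ r hr)).sub ((hn r hr).const_mul K)
    have h3 := ((hasDerivAt_pow 3 r).neg).exp
    have h4 := h2.mul h3
    exact h4.congr_deriv (by simp [Pi.mul_apply, Pi.sub_apply])
  have hΨ' : ∀ r ≥ R, 0 ≤ ((4 * r ^ 3 * ‖p r‖ ^ 2 + r ^ 4 * (2 * inner ℝ (p r) (α r * p r + γ r * s r)))
        - K * (2 * inner ℝ (s r) (ω * p r))) * Real.exp (-r ^ 3) +
        (r ^ 4 * ‖p r‖ ^ 2 - K * ‖s r‖ ^ 2) * (Real.exp (-r ^ 3) * (-(3 * r ^ 2))) := by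
    intro r hr
    have hr1 : 1 ≤ r := hR1.trans hr
    have hrK : K ≤ r := hRK.trans hr
    have key : 0 ≤ ((4 * r ^ 3 * ‖p r‖ ^ 2 + r ^ 4 * (2 * inner ℝ (p r) (α r * p r + γ r * s r)))
        - K * (2 * inner ℝ (s r) (ω * p r))) - 3 * r ^ 2 * (r ^ 4 * ‖p r‖ ^ 2 - K * ‖s r‖ ^ 2) := by
      have a1 := hn_le r
      have a2 := hQ_ge r hr
      set x := ‖p r‖
      set y := ‖s r‖
      have hx : 0 ≤ x := norm_nonneg _
      have hy : 0 ≤ y := norm_nonneg _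
      have a3 : r ^ 4 * (19 / 10 * r ^ 2 * x ^ 2 - C * (x * y)) ≤
          r ^ 4 * inner ℝ (p r) (α r * p r + γ r * s r) := by gcongr
      have a4 : K * inner ℝ (s r) (ω * p r) ≤ K * (y * x) := by gcongr
      have a5 : 0 ≤ r ^ 3 * x ^ 2 := by positivity
      -- reduce to a quadratic form
      have a6 : K ≤ r ^ 4 := hrK.trans (by
        calc r = r ^ 1 := (pow_one r).symm
          _ ≤ r ^ 4 := pow_le_pow_right₀ hr1 (by norm_num))
      have a7 : K * (y * x) ≤ r ^ 4 * (y * x) := by gcongr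
      have a8 : 0 ≤ 4 / 5 * r ^ 6 * x ^ 2 - 2 * (C + 1) * (r ^ 3 * x) * (r * y) + 3 * K * r ^ 2 * y ^ 2 := by
        have : (C + 1) ^ 2 ≤ 2 * K := by rw [hK]; nlinarith [sq_nonneg (C - 1)]
        have b1 : 0 ≤ (r ^ 3 * x * (4/5) - (C + 1) * (r * y)) ^ 2 := sq_nonneg _
        have b2 : (C + 1) ^ 2 * (r * y) ^ 2 ≤ 2 * K * (r * y) ^ 2 := by gcongr
        have b3 : 0 ≤ K * (r * y) ^ 2 := by positivity
        nlinarith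
      nlinarith
    have : ((4 * r ^ 3 * ‖p r‖ ^ 2 + r ^ 4 * (2 * inner ℝ (p r) (α r * p r + γ r * s r)))
        - K * (2 * inner ℝ (s r) (ω * p r))) * Real.exp (-r ^ 3) +
        (r ^ 4 * ‖p r‖ ^ 2 - K * ‖s r‖ ^ 2) * (Real.exp (-r ^ 3) * (-(3 * r ^ 2))) =
        (((4 * r ^ 3 * ‖p r‖ ^ 2 + r ^ 4 * (2 * inner ℝ (p r) (α r * p r + γ r * s r)))
        - K * (2 * inner ℝ (s r) (ω * p r))) - 3 * r ^ 2 * (r ^ 4 * ‖p r‖ ^ 2 - K * ‖s r‖ ^ 2))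
          * Real.exp (-r ^ 3) := by ring
    rw [this]
    exact mul_nonneg key (Real.exp_pos _).le
  have hΨmono : MonotoneOn Ψ (Set.Ici R) := by
    apply monotoneOn_of_deriv_nonneg (convex_Ici R)
    · exact fun t ht => (hΨd t ht).continuousAt.continuousWithinAt
    · intro t ht
      rw [interior_Ici] at ht
      exact (hΨd t (le_of_lt ht)).differentiableAt.differentiableWithinAt
    · intro t ht
      rw [interior_Ici] at ht
      rw [(hΨd t (le_of_lt ht)).deriv]
      exact hΨ' t (le_of_lt ht)
  have hcone : ∀ r ≥ R, r ^ 4 * ‖p r‖ ^ 2 ≤ K * ‖s r‖ ^ 2 := by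
    intro r hr
    by_contra hcon
    push Not at hcon
    have hpos : 0 < Ψ r := mul_pos (by linarith) (Real.exp_pos _)
    have : Ψ r ≤ 0 := by
      refine ge_of_tendsto hgrow ?_
      filter_upwards [eventually_ge_atTop r] with q hq
      refine (hΨmono hr (show R ≤ q from hr.trans hq) hq).trans ?_
      simp only [hΨ]
      gcongr
      have : 0 ≤ K * ‖s q‖ ^ 2 := by positivity
      linarith
    linarith
  have hcone' : ∀ r ≥ R, r ^ 2 * ‖p r‖ ≤ K * ‖s r‖ := by
    intro r hr
    have h1 := hcone r hr
    apply (pow_le_pow_iff_left₀ (by positivity) (by positivity) two_ne_zero).mp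
    have h2 : K * ‖s r‖ ^ 2 ≤ K ^ 2 * ‖s r‖ ^ 2 := by gcongr; nlinarith
    nlinarith
  -- boundedness
  set N : ℝ → ℝ := fun r => ‖s r‖ ^ 2 * Real.exp (2 * K * r⁻¹) with hN
  have hNd : ∀ r ≥ R, HasDerivAt N (2 * inner ℝ (s r) (ω * p r) * Real.exp (2 * K * r⁻¹) +
      ‖s r‖ ^ 2 * (Real.exp (2 * K * r⁻¹) * (2 * K * (-(r ^ 2)⁻¹)))) r := by
    intro r hr
    have hr0 : r ≠ 0 := by linarith
    exact (hn r hr).mul (((hasDerivAt_inv hr0).const_mul (2 * K)).exp)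
  have hNanti : AntitoneOn N (Set.Ici R) := by
    apply antitoneOn_of_deriv_nonpos (convex_Ici R)
    · exact fun t ht => (hNd t ht).continuousAt.continuousWithinAt
    · intro t ht
      rw [interior_Ici] at ht
      exact (hNd t (le_of_lt ht)).differentiableAt.differentiableWithinAt
    · intro t ht
      rw [interior_Ici] at ht
      have ht' : R ≤ t := le_of_lt ht
      rw [(hNd t ht').deriv]
      have ht0 : 0 < t := by linarith
      have a1 := hn_le t
      have a2 := hcone' t ht'
      have a3 : ‖p t‖ ≤ K * ‖s t‖ * (t ^ 2)⁻¹ := by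
        rw [← div_eq_mul_inv, le_div_iff₀ (by positivity)]
        linarith
      have a4 : ‖s t‖ * ‖p t‖ ≤ ‖s t‖ * (K * ‖s t‖ * (t ^ 2)⁻¹) := by gcongr
      have : 2 * inner ℝ (s t) (ω * p t) * Real.exp (2 * K * t⁻¹) +
        ‖s t‖ ^ 2 * (Real.exp (2 * K * t⁻¹) * (2 * K * (-(t ^ 2)⁻¹))) =
        2 * (inner ℝ (s t) (ω * p t) - ‖s t‖ * (K * ‖s t‖ * (t ^ 2)⁻¹)) * Real.exp (2 * K * t⁻¹) := by
        ring
      rw [this]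
      apply mul_nonpos_of_nonpos_of_nonneg _ (Real.exp_pos _).le
      linarith
  have hsb : ∀ r ≥ R, ‖s r‖ ≤ N R + 1 := by
    intro r hr
    have hr0 : 0 < r := by linarith
    have h1 := hNanti (Set.mem_Ici.mpr le_rfl) hr hr
    have h2 : ‖s r‖ ^ 2 ≤ N r := by
      simp only [hN]
      have : 1 ≤ Real.exp (2 * K * r⁻¹) := Real.one_le_exp (by positivity)
      nlinarith [sq_nonneg ‖s r‖]
    nlinarith [sq_nonneg (‖s r‖ - 1)]
  refine ⟨R, K * (N R + 1), fun r hr => ⟨?_, ?_⟩⟩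
  · have := hsb r hr
    nlinarith [norm_nonneg (s r)]
  · refine (hcone' r hr).trans ?_
    have := hsb r hr
    gcongr


lemma re_h_mono (b r c c' : ℝ) (hr : 1 ≤ r)
    (hc : (1 / 2 ≤ c' ∧ c' ≤ c) ∨ (-(1 / 2) ≤ c ∧ c ≤ c' ∧ c' ≤ 1 / 2)) :
    r ^ 3 / 3 * (4 * c' ^ 3 - 3 * c') - b * r * c' ≤
      r ^ 3 / 3 * (4 * c ^ 3 - 3 * c) - b * r * c + b ^ 2 := by
  have hr3 : r ≤ r ^ 3 := by nlinarith [mul_nonneg (by linarith : (0:ℝ) ≤ r) (by nlinarith : 0 ≤ r ^ 2 - 1)]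
  rcases hc with ⟨h1, h2⟩ | ⟨h1, h2, h3⟩
  · obtain ⟨e, rfl⟩ : ∃ e, c = c' + e := ⟨c - c', by ring⟩
    have he : 0 ≤ e := by linarith
    have a1 : 6 * e ≤ 4 * ((c' + e) ^ 2 + (c' + e) * c' + c' ^ 2) - 3 := by nlinarith
    have a2 : r ^ 3 / 3 * e * (6 * e) ≤
        r ^ 3 / 3 * e * (4 * ((c' + e) ^ 2 + (c' + e) * c' + c' ^ 2) - 3) := by gcongr
    have a3 : r ^ 2 * e ^ 2 ≤ r ^ 3 * e ^ 2 := by gcongr <;> linarith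
    nlinarith [sq_nonneg (r * e - b), sq_nonneg (r * e + b), sq_nonneg b]
  · obtain ⟨e, rfl⟩ : ∃ e, c' = c + e := ⟨c' - c, by ring⟩
    have he : 0 ≤ e := by linarith
    have a1 : 2 * e ≤ 3 - 4 * ((c + e) ^ 2 + (c + e) * c + c ^ 2) := by
      nlinarith [mul_nonneg he (by linarith : 0 ≤ 1/2 - (c + e)),
        mul_nonneg (by linarith : 0 ≤ c + 1/2) (by linarith : 0 ≤ 1/2 - (c + e))]
    have a2 : r ^ 3 / 3 * e * (2 * e) ≤
        r ^ 3 / 3 * e * (3 - 4 * ((c + e) ^ 2 + (c + e) * c + c ^ 2)) := by gcongr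
    have a3 : r ^ 2 * e ^ 2 ≤ r ^ 3 * e ^ 2 := by gcongr <;> linarith
    nlinarith [sq_nonneg (r * e - b), sq_nonneg (r * e + b), sq_nonneg b]

lemma re_h_arc (b r θ : ℝ) :
    (((r : ℂ) * Complex.exp (θ * I)) ^ 3 / 3 - b * ((r : ℂ) * Complex.exp (θ * I))).re =
      r ^ 3 / 3 * (4 * Real.cos θ ^ 3 - 3 * Real.cos θ) - b * r * Real.cos θ := by
  have h1 : ((r : ℂ) * Complex.exp (θ * I)) ^ 3 / 3 =
      ((r ^ 3 / 3 : ℝ) : ℂ) * Complex.exp (((3 * θ : ℝ) : ℂ) * I) := by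
    rw [mul_pow, ← Complex.exp_nat_mul]
    push_cast
    rw [show (3 : ℂ) * (θ * I) = 3 * θ * I by ring]
    ring
  rw [h1, Complex.sub_re, Complex.re_ofReal_mul, Complex.exp_ofReal_mul_I_re, Complex.re_ofReal_mul,
    Complex.re_ofReal_mul, Complex.exp_ofReal_mul_I_re, Real.cos_three_mul]
  ring

set_option maxHeartbeats 1000000 in
lemma arc_lemma (s p c : ℂ → ℂ) (m b K0 Cc R0 : ℝ) (hm : 0 ≤ m) (M : ℕ) (hM : (M : ℝ) = 2 * m)
    (hCc : 0 ≤ Cc)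
    (hs : ∀ z : ℂ, z ≠ 0 → HasDerivAt s (p z) z)
    (hp : ∀ z : ℂ, z ≠ 0 → HasDerivAt p (-(2 * (z ^ 2 - b) - 2 * m / z) * p z - c z * s z) z)
    (hc : ∀ z : ℂ, 1 ≤ ‖z‖ → ‖c z‖ ≤ Cc)
    (hray : ∀ r ≥ R0, ‖s ((r : ℂ) * Complex.exp ((Real.pi / 3 : ℝ) * I))‖ ≤ K0 ∧
      r ^ 2 * ‖p ((r : ℂ) * Complex.exp ((Real.pi / 3 : ℝ) * I))‖ ≤ K0) :
    ∃ R K : ℝ, ∀ r ≥ R, ∀ θ ∈ Set.Icc (0:ℝ) (2 * Real.pi / 3),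
      ‖s ((r : ℂ) * Complex.exp (θ * I))‖ ≤ K := by
  have hpi := Real.pi_pos
  set CE : ℝ := Real.exp (2 * b ^ 2) with hCE
  have hCE0 : 0 < CE := Real.exp_pos _
  set A : ℝ := (Real.pi * (2 * m + 4) + 1) * (CE * (Real.pi * Cc)) + Real.pi * Cc with hA
  have hA0 : 0 ≤ A := by positivity
  set B : ℝ := 2 * K0 + (Real.pi * (2 * m + 4) + 1) * (CE * K0) with hB
  refine ⟨max R0 (max (2 * |b| + 1) (2 * A)), 2 * B, ?_⟩
  intro r hr
  have hrR0 : R0 ≤ r := (le_max_left _ _).trans hr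
  have hrb : 2 * |b| + 1 ≤ r := ((le_max_left _ _).trans (le_max_right _ _)).trans hr
  have hrA : 2 * A ≤ r := ((le_max_right _ _).trans (le_max_right _ _)).trans hr
  have hr1 : 1 ≤ r := by linarith [abs_nonneg b]
  have hr0 : 0 < r := by linarith
  have hr12 : 1 ≤ r ^ 2 := by nlinarith
  set Z : ℝ → ℂ := fun θ => (r : ℂ) * Complex.exp (θ * I) with hZ
  have hZn : ∀ θ, ‖Z θ‖ = r := by
    intro θ
    simp only [hZ, norm_mul, Complex.norm_exp_ofReal_mul_I, Complex.norm_real, Real.norm_eq_abs,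
      abs_of_pos hr0, mul_one]
  have hZ0 : ∀ θ, Z θ ≠ 0 := by
    intro θ h
    have := hZn θ
    rw [h, norm_zero] at this
    linarith
  have hZd : ∀ θ, HasDerivAt Z (Z θ * I) θ := by
    intro θ
    have h1 : HasDerivAt (fun θ : ℝ => (θ : ℂ) * I) I θ := by
      simpa using ((hasDerivAt_id θ).ofReal_comp).mul_const I
    exact (h1.cexp.const_mul (r : ℂ)).congr_deriv (by simp only [hZ]; ring)
  obtain ⟨hs0, hp0⟩ := hray r hrR0
  change ‖s (Z (Real.pi / 3))‖ ≤ K0 at hs0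
  change r ^ 2 * ‖p (Z (Real.pi / 3))‖ ≤ K0 at hp0
  have hK0 : 0 ≤ K0 := (norm_nonneg _).trans hs0
  have hp0' : ‖p (Z (Real.pi / 3))‖ ≤ K0 := by nlinarith [norm_nonneg (p (Z (Real.pi / 3)))]
  -- the maximum
  have hsc : ContinuousOn (fun θ => ‖s (Z θ)‖) (Set.Icc (0:ℝ) (2 * Real.pi / 3)) := fun θ _ =>
    (((hs _ (hZ0 θ)).comp θ (hZd θ)).continuousAt.norm).continuousWithinAt
  obtain ⟨θm, hθm, hmax⟩ := isCompact_Icc.exists_isMaxOn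
    (Set.nonempty_Icc.mpr (by positivity : (0:ℝ) ≤ 2 * Real.pi / 3)) hsc
  set S : ℝ := ‖s (Z θm)‖ with hS
  have hS0 : 0 ≤ S := norm_nonneg _
  have hSmax : ∀ θ ∈ Set.Icc (0:ℝ) (2 * Real.pi / 3), ‖s (Z θ)‖ ≤ S := fun θ hθ => hmax hθ
  have h3mem : Real.pi / 3 ∈ Set.Icc (0:ℝ) (2 * Real.pi / 3) := ⟨by positivity, by linarith⟩
  have hsub : ∀ θ ∈ Set.Icc (0:ℝ) (2 * Real.pi / 3),
      Set.uIcc (Real.pi / 3) θ ⊆ Set.Icc (0:ℝ) (2 * Real.pi / 3) := fun θ hθ =>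
    Set.uIcc_subset_Icc h3mem hθ
  have hlen : ∀ θ ∈ Set.Icc (0:ℝ) (2 * Real.pi / 3), ‖θ - Real.pi / 3‖ ≤ Real.pi := by
    intro θ hθ
    rw [Real.norm_eq_abs, abs_le]
    constructor <;> linarith [hθ.1, hθ.2]
  -- integrating factor
  set E : ℂ → ℂ := fun z => Complex.exp (2 * (z ^ 3 / 3 - b * z)) * (z ^ M)⁻¹ with hE
  have hEd : ∀ z : ℂ, z ≠ 0 → HasDerivAt E ((2 * (z ^ 2 - b) - 2 * m / z) * E z) z := by
    intro z hz
    have h1 : HasDerivAt (fun z : ℂ => 2 * (z ^ 3 / 3 - b * z)) (2 * (z ^ 2 - b)) z := by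
      have := (((hasDerivAt_pow 3 z).div_const 3).sub ((hasDerivAt_id z).const_mul (b : ℂ))).const_mul 2
      refine this.congr_deriv ?_
      simp
    have h2 := (hasDerivAt_pow M z).inv (pow_ne_zero M hz)
    have h3 := h1.cexp.mul h2
    refine h3.congr_deriv ?_
    have hM' : (M : ℂ) = 2 * m := by exact_mod_cast hM
    have hzp : (M : ℂ) * z ^ (M - 1) = 2 * m * (z ^ M / z) := by
      rcases Nat.eq_zero_or_pos M with h | h
      · rw [← hM', h]; simp
      · rw [hM']
        congr 1
        rw [eq_div_iff hz, ← pow_succ]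
        congr 1
        omega
    simp only [hE, Pi.inv_apply]
    rw [hzp]
    have : z ^ M ≠ 0 := pow_ne_zero _ hz
    field_simp
    ring
  have hEn : ∀ θ, ‖E (Z θ)‖ = Real.exp (2 * (r ^ 3 / 3 * (4 * Real.cos θ ^ 3 - 3 * Real.cos θ) -
      b * r * Real.cos θ)) * (r ^ M)⁻¹ := by
    intro θ
    simp only [hE]
    rw [norm_mul, norm_inv, norm_pow, hZn, Complex.norm_exp]
    congr 2
    have := re_h_arc b r θ
    rw [← this]
    simp [hZ]
  have hEcmp : ∀ θ ∈ Set.Icc (0:ℝ) (2 * Real.pi / 3), ∀ θ' ∈ Set.uIcc (Real.pi / 3) θ,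
      ‖E (Z θ')‖ ≤ CE * ‖E (Z θ)‖ := by
    intro θ hθ θ' hθ'
    rw [hEn, hEn, hCE, ← mul_assoc, ← Real.exp_add]
    gcongr
    have hkey : (1 / 2 ≤ Real.cos θ' ∧ Real.cos θ' ≤ Real.cos θ) ∨
        (-(1 / 2) ≤ Real.cos θ ∧ Real.cos θ ≤ Real.cos θ' ∧ Real.cos θ' ≤ 1 / 2) := by
      have hc3 : Real.cos (Real.pi / 3) = 1 / 2 := Real.cos_pi_div_three
      have hc23 : Real.cos (2 * Real.pi / 3) = -(1 / 2) := by
        rw [show 2 * Real.pi / 3 = Real.pi - Real.pi / 3 by ring, Real.cos_pi_sub, hc3]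
      rcases le_total θ (Real.pi / 3) with h | h
      · left
        rw [Set.uIcc_of_ge h] at hθ'
        constructor
        · rw [← hc3]
          exact Real.cos_le_cos_of_nonneg_of_le_pi (hθ.1.trans hθ'.1) (by linarith) hθ'.2
        · exact Real.cos_le_cos_of_nonneg_of_le_pi hθ.1 (by linarith [hθ'.2]) hθ'.1
      · right
        rw [Set.uIcc_of_le h] at hθ'
        have := hθ.2
        refine ⟨?_, ?_, ?_⟩
        · rw [← hc23]
          exact Real.cos_le_cos_of_nonneg_of_le_pi hθ.1 (by linarith) hθ.2
        · exact Real.cos_le_cos_of_nonneg_of_le_pi (by linarith [hθ'.1]) (by linarith) hθ'.2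
        · rw [← hc3]
          exact Real.cos_le_cos_of_nonneg_of_le_pi (by positivity) (by linarith [hθ'.2]) hθ'.1
    have := re_h_mono b r _ _ hr1 hkey
    linarith
  clear_value E
  set P : ℝ := CE * (K0 + Real.pi * Cc * (r * S)) with hP
  have hP0 : 0 ≤ P := by positivity
  have hPb : ∀ θ ∈ Set.Icc (0:ℝ) (2 * Real.pi / 3), ‖p (Z θ)‖ ≤ P := by
    intro θ hθ
    have hD : ∀ x ∈ Set.uIcc (Real.pi / 3) θ, HasDerivWithinAt (fun x => p (Z x) * E (Z x))
        (-(c (Z x) * s (Z x)) * E (Z x) * (Z x * I)) (Set.uIcc (Real.pi / 3) θ) x := by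
      intro x _
      have h1 := (hp _ (hZ0 x)).comp x (hZd x)
      have h2 := (hEd _ (hZ0 x)).comp x (hZd x)
      have h3 := h1.mul h2
      refine (h3.congr_deriv ?_).hasDerivWithinAt
      simp only [Function.comp_apply]
      ring
    have hb : ∀ x ∈ Set.uIcc (Real.pi / 3) θ,
        ‖-(c (Z x) * s (Z x)) * E (Z x) * (Z x * I)‖ ≤ Cc * S * (CE * ‖E (Z θ)‖) * r := by
      intro x hx
      rw [norm_mul, norm_mul, norm_mul, norm_neg, norm_mul, hZn, Complex.norm_I, mul_one]
      gcongr
      · exact hc _ (by rw [hZn]; exact hr1)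
      · exact hSmax x (hsub θ hθ hx)
      · exact hEcmp θ hθ x hx
    have h4 := (convex_uIcc (Real.pi / 3) θ).norm_image_sub_le_of_norm_hasDerivWithin_le hD hb
      Set.left_mem_uIcc Set.right_mem_uIcc
    have hEpos : 0 < ‖E (Z θ)‖ := by
      rw [hEn]; positivity
    have h5 : ‖p (Z θ) * E (Z θ)‖ ≤ ‖p (Z (Real.pi / 3)) * E (Z (Real.pi / 3))‖ +
        Cc * S * (CE * ‖E (Z θ)‖) * r * ‖θ - Real.pi / 3‖ := by
      have := norm_le_norm_add_norm_sub' (p (Z θ) * E (Z θ)) (p (Z (Real.pi / 3)) * E (Z (Real.pi / 3)))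
      linarith
    rw [norm_mul, norm_mul] at h5
    have h6 : ‖p (Z (Real.pi / 3))‖ * ‖E (Z (Real.pi / 3))‖ ≤ K0 * (CE * ‖E (Z θ)‖) := by
      gcongr
      exact hEcmp θ hθ _ Set.left_mem_uIcc
    have h7 : Cc * S * (CE * ‖E (Z θ)‖) * r * ‖θ - Real.pi / 3‖ ≤
        Cc * S * (CE * ‖E (Z θ)‖) * r * Real.pi := by
      gcongr; exact hlen θ hθ
    refine le_of_mul_le_mul_right ?_ hEpos
    calc ‖p (Z θ)‖ * ‖E (Z θ)‖ ≤ K0 * (CE * ‖E (Z θ)‖) + Cc * S * (CE * ‖E (Z θ)‖) * r * Real.pi := by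
          linarith
      _ = P * ‖E (Z θ)‖ := by rw [hP]; ring
  -- the corrected quantity
  have hq : ∀ z : ℂ, ‖z‖ = r → r ^ 2 / 2 ≤ ‖z ^ 2 - (b : ℂ)‖ := by
    intro z hz
    have h1 := norm_sub_norm_le (z ^ 2) (b : ℂ)
    rw [norm_pow, hz, Complex.norm_real, Real.norm_eq_abs] at h1
    nlinarith [abs_nonneg b]
  have hq0 : ∀ z : ℂ, ‖z‖ = r → z ^ 2 - (b : ℂ) ≠ 0 := by
    intro z hz h
    have := hq z hz
    rw [h, norm_zero] at this
    nlinarith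
  have hcorr : ∀ θ ∈ Set.Icc (0:ℝ) (2 * Real.pi / 3),
      ‖p (Z θ) / (2 * (Z θ ^ 2 - b))‖ ≤ ‖p (Z θ)‖ / r ^ 2 := by
    intro θ _
    rw [norm_div, norm_mul]
    have := hq (Z θ) (hZn θ)
    have h2 : ‖(2:ℂ)‖ = 2 := by simp
    rw [h2]
    gcongr
    linarith
  have hmain : ∀ θ ∈ Set.Icc (0:ℝ) (2 * Real.pi / 3), ‖s (Z θ)‖ ≤ B + A / r * S := by
    intro θ hθ
    have hD : ∀ x ∈ Set.uIcc (Real.pi / 3) θ, HasDerivWithinAt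
        (fun x => s (Z x) + p (Z x) / (2 * (Z x ^ 2 - b)))
        ((p (Z x) * (m / (Z x * (Z x ^ 2 - b)) - Z x / (Z x ^ 2 - b) ^ 2) -
          c (Z x) * s (Z x) / (2 * (Z x ^ 2 - b))) * (Z x * I)) (Set.uIcc (Real.pi / 3) θ) x := by
      intro x _
      have hz0 := hZ0 x
      have hqq := hq0 _ (hZn x)
      have h1 := hp _ hz0
      have h2 := hs _ hz0
      have h3 : HasDerivAt (fun z : ℂ => 2 * (z ^ 2 - (b : ℂ))) (2 * (2 * Z x)) (Z x) := by
        refine (((hasDerivAt_pow 2 (Z x)).sub_const (b : ℂ)).const_mul 2).congr_deriv ?_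
        simp
      have h4 := h2.add (h1.div h3 (mul_ne_zero two_ne_zero hqq))
      have h5 := h4.comp x (hZd x)
      refine (h5.congr_deriv ?_).hasDerivWithinAt
      congr 1
      field_simp
      ring
    have hb : ∀ x ∈ Set.uIcc (Real.pi / 3) θ,
        ‖(p (Z x) * (m / (Z x * (Z x ^ 2 - b)) - Z x / (Z x ^ 2 - b) ^ 2) -
          c (Z x) * s (Z x) / (2 * (Z x ^ 2 - b))) * (Z x * I)‖ ≤
          (P * (m / (r * (r ^ 2 / 2)) + r / (r ^ 2 / 2) ^ 2) + Cc * S / (2 * (r ^ 2 / 2))) * r := by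
      intro x hx
      have hq1 := hq (Z x) (hZn x)
      have hx' := hsub θ hθ hx
      rw [norm_mul, norm_mul (Z x), hZn, Complex.norm_I, mul_one]
      gcongr
      refine (norm_sub_le _ _).trans ?_
      have e1 : ‖(m : ℂ) / (Z x * (Z x ^ 2 - b)) - Z x / (Z x ^ 2 - b) ^ 2‖ ≤
          m / (r * (r ^ 2 / 2)) + r / (r ^ 2 / 2) ^ 2 := by
        refine (norm_sub_le _ _).trans ?_
        rw [norm_div, norm_div, norm_mul, norm_pow, hZn, Complex.norm_real, Real.norm_eq_abs,
          abs_of_nonneg hm]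
        gcongr
      have e2 : ‖c (Z x) * s (Z x) / (2 * (Z x ^ 2 - b))‖ ≤ Cc * S / (2 * (r ^ 2 / 2)) := by
        rw [norm_div, norm_mul, norm_mul, (by simp : ‖(2:ℂ)‖ = 2)]
        gcongr
        · exact hc _ (by rw [hZn]; exact hr1)
        · exact hSmax x hx'
      rw [norm_mul]
      have e3 := hPb x hx'
      gcongr
    have h4 := (convex_uIcc (Real.pi / 3) θ).norm_image_sub_le_of_norm_hasDerivWithin_le hD hb
      Set.left_mem_uIcc Set.right_mem_uIcc
    have h4' : ‖s (Z θ) + p (Z θ) / (2 * (Z θ ^ 2 - b)) -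
        (s (Z (Real.pi / 3)) + p (Z (Real.pi / 3)) / (2 * (Z (Real.pi / 3) ^ 2 - b)))‖ ≤
        (P * (m / (r * (r ^ 2 / 2)) + r / (r ^ 2 / 2) ^ 2) + Cc * S / (2 * (r ^ 2 / 2))) * r * Real.pi := by
      refine h4.trans ?_
      gcongr
      exact hlen θ hθ
    have h5 : (P * (m / (r * (r ^ 2 / 2)) + r / (r ^ 2 / 2) ^ 2) + Cc * S / (2 * (r ^ 2 / 2))) * r * Real.pi
        = Real.pi * (2 * m + 4) * (P / r ^ 2) + Real.pi * Cc * S / r := by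
      field_simp
      ring
    have h6 := hcorr θ hθ
    have h7 := hcorr _ h3mem
    have h8 : ‖p (Z θ)‖ / r ^ 2 ≤ P / r ^ 2 := by
      gcongr; exact hPb θ hθ
    have h9 : ‖p (Z (Real.pi / 3))‖ / r ^ 2 ≤ K0 := by
      rw [div_le_iff₀ (by positivity)]
      nlinarith
    have h10 : P / r ^ 2 ≤ CE * K0 + CE * (Real.pi * Cc) * S / r := by
      have : P / r ^ 2 = CE * K0 / r ^ 2 + CE * (Real.pi * Cc) * S / r := by
        rw [hP]; field_simp
      rw [this]
      gcongr
      exact div_le_self (by positivity) hr12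
    have h11 : ‖s (Z θ)‖ ≤ ‖s (Z θ) + p (Z θ) / (2 * (Z θ ^ 2 - b)) -
        (s (Z (Real.pi / 3)) + p (Z (Real.pi / 3)) / (2 * (Z (Real.pi / 3) ^ 2 - b)))‖ +
        ‖s (Z (Real.pi / 3))‖ + ‖p (Z (Real.pi / 3)) / (2 * (Z (Real.pi / 3) ^ 2 - b))‖ +
        ‖p (Z θ) / (2 * (Z θ ^ 2 - b))‖ := by
      have e : s (Z θ) = (s (Z θ) + p (Z θ) / (2 * (Z θ ^ 2 - b)) -
        (s (Z (Real.pi / 3)) + p (Z (Real.pi / 3)) / (2 * (Z (Real.pi / 3) ^ 2 - b)))) +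
        s (Z (Real.pi / 3)) + p (Z (Real.pi / 3)) / (2 * (Z (Real.pi / 3) ^ 2 - b)) -
        p (Z θ) / (2 * (Z θ ^ 2 - b)) := by ring
      conv_lhs => rw [e]
      refine (norm_sub_le _ _).trans ?_
      gcongr
      refine (norm_add_le _ _).trans ?_
      gcongr
      exact norm_add_le _ _
    have h12 : (Real.pi * (2 * m + 4) + 1) * (P / r ^ 2) ≤
        (Real.pi * (2 * m + 4) + 1) * (CE * K0 + CE * (Real.pi * Cc) * S / r) := by gcongr
    have h13 : B + A / r * S = 2 * K0 + (Real.pi * (2 * m + 4) + 1) * (CE * K0 + CE * (Real.pi * Cc) * S / r)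
        + Real.pi * Cc * S / r := by
      rw [hB, hA]; ring
    rw [h13]
    linarith
  have hAr : A / r ≤ 1 / 2 := by
    rw [div_le_iff₀ hr0]; linarith
  have hSB : S ≤ 2 * B := by
    have h1 := hmain θm hθm
    have h2 : A / r * S ≤ 1 / 2 * S := by gcongr
    change S ≤ _ at h1
    linarith
  intro θ hθ
  exact (hSmax θ hθ).trans hSB

/-- the direction of the ray at angle one third of pi -/
noncomputable def rayDir : ℂ := Complex.exp ((Real.pi / 3 : ℝ) * I)

lemma rayDir_norm : ‖rayDir‖ = 1 := by
  unfold rayDir; exact Complex.norm_exp_ofReal_mul_I _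

lemma rayDir_cube : rayDir ^ 3 = -1 := by
  unfold rayDir
  rw [← Complex.exp_nat_mul]
  have : ((3:ℕ):ℂ) * ((Real.pi / 3 : ℝ) * I) = Real.pi * I := by push_cast; ring
  rw [this, Complex.exp_pi_mul_I]

lemma rayDir_re : rayDir.re = 1 / 2 := by
  unfold rayDir
  rw [Complex.exp_ofReal_mul_I_re, Real.cos_pi_div_three]

/-- growth along the ray, at most polynomial times the growing exponential -/
def RayGrowth (b : ℝ) (f : ℂ → ℂ) : Prop :=
  ∃ (C : ℝ) (N : ℕ), 0 ≤ C ∧ ∀ r : ℝ, 1 ≤ r →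
    ‖f (r * rayDir)‖ ≤ C * r ^ N * Real.exp (r ^ 3 / 3 + b * r / 2)

lemma RayGrowth.add {b : ℝ} {f g : ℂ → ℂ} (hf : RayGrowth b f) (hg : RayGrowth b g) :
    RayGrowth b (fun z => f z + g z) := by
  obtain ⟨C, N, hC, h⟩ := hf
  obtain ⟨C', N', hC', h'⟩ := hg
  refine ⟨C + C', N + N', by positivity, fun r hr => ?_⟩
  have h1 : r ^ N ≤ r ^ (N + N') := pow_le_pow_right₀ hr (by omega)
  have h2 : r ^ N' ≤ r ^ (N + N') := pow_le_pow_right₀ hr (by omega)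
  calc ‖f (r * rayDir) + g (r * rayDir)‖ ≤ C * r ^ N * Real.exp (r ^ 3 / 3 + b * r / 2) +
        C' * r ^ N' * Real.exp (r ^ 3 / 3 + b * r / 2) :=
        (norm_add_le _ _).trans (add_le_add (h r hr) (h' r hr))
    _ ≤ C * r ^ (N + N') * Real.exp (r ^ 3 / 3 + b * r / 2) +
        C' * r ^ (N + N') * Real.exp (r ^ 3 / 3 + b * r / 2) := by gcongr
    _ = _ := by ring

lemma RayGrowth.const_mul {b : ℝ} {f : ℂ → ℂ} (hf : RayGrowth b f) (c : ℂ) :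
    RayGrowth b (fun z => c * f z) := by
  obtain ⟨C, N, hC, h⟩ := hf
  refine ⟨‖c‖ * C, N, by positivity, fun r hr => ?_⟩
  rw [norm_mul]
  calc ‖c‖ * ‖f (r * rayDir)‖ ≤ ‖c‖ * (C * r ^ N * Real.exp (r ^ 3 / 3 + b * r / 2)) := by
        gcongr; exact h r hr
    _ = _ := by ring

lemma RayGrowth.id_mul {b : ℝ} {f : ℂ → ℂ} (hf : RayGrowth b f) :
    RayGrowth b (fun z => z * f z) := by
  obtain ⟨C, N, hC, h⟩ := hf
  refine ⟨C, N + 1, by positivity, fun r hr => ?_⟩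
  rw [norm_mul, norm_mul, rayDir_norm, Complex.norm_real, Real.norm_eq_abs,
    abs_of_nonneg (by linarith), mul_one]
  calc r * ‖f (r * rayDir)‖ ≤ r * (C * r ^ N * Real.exp (r ^ 3 / 3 + b * r / 2)) := by
        gcongr; exact h r hr
    _ = _ := by ring

lemma RayGrowth.pow_mul {b : ℝ} {f : ℂ → ℂ} (hf : RayGrowth b f) (k : ℕ) :
    RayGrowth b (fun z => z ^ k * f z) := by
  induction k with
  | zero => simpa using hf
  | succ k ih =>
    have := ih.id_mul
    have e : (fun z : ℂ => z * (z ^ k * f z)) = (fun z => z ^ (k + 1) * f z) := by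
      funext z; ring
    rwa [e] at this

lemma RayGrowth.tendsto {b : ℝ} {f : ℂ → ℂ} (hf : RayGrowth b f) :
    Tendsto (fun r : ℝ => r ^ 4 * ‖f (r * rayDir)‖ ^ 2 * Real.exp (-r ^ 3)) atTop (nhds 0) := by
  obtain ⟨C, N, hC, h⟩ := hf
  have h0 := (Real.tendsto_pow_mul_exp_neg_atTop_nhds_zero (4 + 2 * N)).const_mul (C ^ 2)
  rw [mul_zero] at h0
  refine squeeze_zero' (Eventually.of_forall fun r => by positivity) ?_ h0
  filter_upwards [eventually_ge_atTop (3 * (|b| + 1) + 1)] with r hr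
  have hb := abs_nonneg b
  have hr1 : 1 ≤ r := by linarith
  have hexp : 2 * (r ^ 3 / 3 + b * r / 2) + -r ^ 3 ≤ -r := by
    have h1 : b * r ≤ |b| * r := by gcongr; exact le_abs_self b
    have h2 : 3 * (|b| + 1) ≤ r ^ 2 := by nlinarith
    have h3 : 3 * (|b| + 1) * r ≤ r ^ 2 * r := by gcongr
    nlinarith
  calc r ^ 4 * ‖f (r * rayDir)‖ ^ 2 * Real.exp (-r ^ 3)
      ≤ r ^ 4 * (C * r ^ N * Real.exp (r ^ 3 / 3 + b * r / 2)) ^ 2 * Real.exp (-r ^ 3) := by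
        gcongr; exact h r hr1
    _ = C ^ 2 * (r ^ (4 + 2 * N) * Real.exp (2 * (r ^ 3 / 3 + b * r / 2) + -r ^ 3)) := by
        generalize r ^ 3 / 3 + b * r / 2 = x
        rw [Real.exp_add, two_mul x, Real.exp_add]; ring
    _ ≤ _ := by gcongr

lemma sector_bound (n : ℕ) (b : ℝ) (μ : ℂ) (v : ℂ → ℂ) (hv : Differentiable ℂ v)
    (hode : ∀ z, deriv (deriv v) z + 2 * (z ^ 2 - b) * deriv v z
      + (2 * ((n : ℂ) + 2) * z + μ) * v z = 0)
    (g0 : RayGrowth b v) (g1 : RayGrowth b (deriv v)) :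
    ∃ R K : ℝ, ∀ r ≥ R, ∀ θ ∈ Set.Icc (0:ℝ) (2 * Real.pi / 3),
      ‖((r : ℂ) * Complex.exp (θ * I)) ^ (n + 2) * v (r * Complex.exp (θ * I))‖ ≤ K := by
  set m : ℝ := (n : ℝ) + 2 with hm
  have hmc : (m : ℂ) = (n : ℂ) + 2 := by rw [hm]; push_cast; ring
  set s : ℂ → ℂ := fun z => z ^ (n + 2) * v z with hsdef
  set p : ℂ → ℂ := fun z => z ^ (n + 2) * deriv v z + ((n : ℂ) + 2) * (z ^ (n + 1) * v z) with hpdef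
  set c : ℂ → ℂ := fun z => μ + 2 * b * m / z + m * (m + 1) / z ^ 2 with hcdef
  have hv' : Differentiable ℂ (deriv v) := fun z =>
    ((hv.contDiff (n := 2)).differentiable_deriv_two z)
  have hs : ∀ z : ℂ, z ≠ 0 → HasDerivAt s (p z) z := by
    intro z _
    refine ((hasDerivAt_pow (n + 2) z).mul (hv z).hasDerivAt).congr_deriv ?_
    simp only [hpdef]
    push_cast
    ring
  have hp : ∀ z : ℂ, z ≠ 0 →
      HasDerivAt p (-(2 * (z ^ 2 - b) - 2 * m / z) * p z - c z * s z) z := by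
    intro z hz
    have h1 := ((hasDerivAt_pow (n + 2) z).mul (hv' z).hasDerivAt).add
      (((hasDerivAt_pow (n + 1) z).mul (hv z).hasDerivAt).const_mul ((n : ℂ) + 2))
    refine h1.congr_deriv ?_
    have h2 : deriv (deriv v) z = -(2 * (z ^ 2 - b) * deriv v z)
      - (2 * ((n : ℂ) + 2) * z + μ) * v z := by linear_combination hode z
    rw [h2]
    simp only [hpdef, hcdef, hsdef, hmc]
    push_cast
    field_simp
    ring
  have hc : ∀ z : ℂ, 1 ≤ ‖z‖ → ‖c z‖ ≤ ‖μ‖ + 2 * |b| * m + m * (m + 1) := by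
    intro z hz
    have hm0 : 0 ≤ m := by positivity
    have e1 : ‖2 * (b:ℂ) * m / z‖ ≤ 2 * |b| * m := by
      rw [norm_div, norm_mul, norm_mul, Complex.norm_real, Complex.norm_real, Real.norm_eq_abs,
        Real.norm_eq_abs, abs_of_nonneg hm0, (by simp : ‖(2:ℂ)‖ = 2)]
      exact div_le_self (by positivity) hz
    have e2 : ‖(m:ℂ) * (m + 1) / z ^ 2‖ ≤ m * (m + 1) := by
      rw [norm_div, norm_pow, show (m:ℂ) * (m + 1) = ((m * (m + 1) : ℝ) : ℂ) by push_cast; ring,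
        Complex.norm_real, Real.norm_eq_abs, abs_of_nonneg (by positivity)]
      exact div_le_self (by positivity) (one_le_pow₀ hz)
    calc ‖c z‖ ≤ ‖μ‖ + ‖2 * (b:ℂ) * m / z‖ + ‖(m:ℂ) * (m + 1) / z ^ 2‖ := norm_add₃_le
      _ ≤ _ := by linarith
  have hCc : 0 ≤ ‖μ‖ + 2 * |b| * m + m * (m + 1) := by positivity
  have gp : RayGrowth b p :=
    (g1.pow_mul (n + 2)).add ((g0.pow_mul (n + 1)).const_mul ((n : ℂ) + 2))
  have hray : ∃ R K : ℝ, ∀ r ≥ R, ‖s (r * rayDir)‖ ≤ K ∧ r ^ 2 * ‖p (r * rayDir)‖ ≤ K := by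
    have hZd : ∀ r : ℝ, HasDerivAt (fun r : ℝ => (r : ℂ) * rayDir) rayDir r := by
      intro r
      simpa using (Complex.ofRealCLM.hasDerivAt (x := r)).mul_const rayDir
    have hω0 : rayDir ≠ 0 := by
      intro h; have := rayDir_norm; rw [h] at this; simp at this
    have hz0 : ∀ r : ℝ, r ≥ 10 * |b| + 1 → (r : ℂ) * rayDir ≠ 0 := by
      intro r hr
      have : (r : ℂ) ≠ 0 := by
        exact_mod_cast (by linarith [abs_nonneg b] : (0:ℝ) < r).ne'
      exact mul_ne_zero this hω0
    refine ray_system (fun r => s (r * rayDir)) (fun r => p (r * rayDir))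
      (fun r => -rayDir * (2 * (((r : ℂ) * rayDir) ^ 2 - b) - 2 * m / ((r : ℂ) * rayDir)))
      (fun r => -rayDir * c (r * rayDir)) rayDir rayDir_norm (10 * |b| + 1)
      (‖μ‖ + 2 * |b| * m + m * (m + 1)) hCc ?_ ?_ ?_ ?_ gp.tendsto
    · intro r hr
      refine ((hs _ (hz0 r hr)).comp r (hZd r)).congr_deriv ?_
      ring
    · intro r hr
      refine ((hp _ (hz0 r hr)).comp r (hZd r)).congr_deriv ?_
      ring
    · intro r hr
      have hb := abs_nonneg b
      have hr0 : 0 < r := by linarith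
      have hrc : (r : ℂ) ≠ 0 := by exact_mod_cast hr0.ne'
      have e : -rayDir * (2 * (((r : ℂ) * rayDir) ^ 2 - b) - 2 * m / ((r : ℂ) * rayDir))
          = ((2 * r ^ 2 + 2 * m / r : ℝ) : ℂ) + ((2 * b : ℝ) : ℂ) * rayDir := by
        have h3 := rayDir_cube
        push_cast
        field_simp
        linear_combination (-(r:ℂ) ^ 3) * h3
      rw [e, Complex.add_re, Complex.ofReal_re, Complex.re_ofReal_mul, rayDir_re]
      have h1 : 0 ≤ 2 * m / r := by positivity
      have h2 := neg_abs_le b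
      nlinarith
    · intro r hr
      rw [norm_mul, norm_neg, rayDir_norm, one_mul]
      apply hc
      rw [norm_mul, rayDir_norm, mul_one, Complex.norm_real, Real.norm_eq_abs]
      exact le_trans (by linarith [abs_nonneg b]) (le_abs_self r)
  obtain ⟨R0, K0, hray⟩ := hray
  exact arc_lemma s p c m b K0 _ R0 (by positivity) (2 * (n + 2)) (by rw [hm]; push_cast; ring) hCc
    hs hp hc hray

lemma conj_ode (n : ℕ) (b : ℝ) (μ : ℂ) (v : ℂ → ℂ)
    (hode : ∀ z, deriv (deriv v) z + 2 * (z ^ 2 - b) * deriv v z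
      + (2 * ((n : ℂ) + 2) * z + μ) * v z = 0) (w : ℂ → ℂ)
    (hw : w = fun z => (starRingEnd ℂ) (v ((starRingEnd ℂ) z))) :
    (∀ z, deriv w z = (starRingEnd ℂ) (deriv v ((starRingEnd ℂ) z))) ∧
    ∀ z, deriv (deriv w) z + 2 * (z ^ 2 - b) * deriv w z
      + (2 * ((n : ℂ) + 2) * z + (starRingEnd ℂ) μ) * w z = 0 := by
  have hw' : w = (starRingEnd ℂ) ∘ v ∘ (starRingEnd ℂ) := by rw [hw]; rfl
  have h1 : ∀ z, deriv w z = (starRingEnd ℂ) (deriv v ((starRingEnd ℂ) z)) := by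
    intro z
    rw [hw', deriv_conj_conj]
    rfl
  refine ⟨h1, fun z => ?_⟩
  have h1' : deriv w = (starRingEnd ℂ) ∘ (deriv v) ∘ (starRingEnd ℂ) := by
    funext z; rw [h1]; rfl
  have h2 : deriv (deriv w) z = (starRingEnd ℂ) (deriv (deriv v) ((starRingEnd ℂ) z)) := by
    rw [h1', deriv_conj_conj]
    rfl
  have h3 := congrArg (starRingEnd ℂ) (hode ((starRingEnd ℂ) z))
  rw [h2, h1, hw]
  simpa [Complex.conj_ofNat] using h3

lemma half_bound (n : ℕ) (v : ℂ → ℂ) (R K : ℝ)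
    (h : ∀ r ≥ R, ∀ θ ∈ Set.Icc (0:ℝ) (2 * Real.pi / 3),
      ‖((r : ℂ) * Complex.exp (θ * I)) ^ (n + 2) * v (r * Complex.exp (θ * I))‖ ≤ K)
    (z : ℂ) (hz : max R 1 ≤ ‖z‖) (hre : -(‖z‖ / 2) ≤ z.re) (him : 0 ≤ z.im) :
    ‖z ^ (n + 2) * v z‖ ≤ K := by
  have hz1 : 1 ≤ ‖z‖ := (le_max_right _ _).trans hz
  have hz0 : z ≠ 0 := by
    intro h0; rw [h0, norm_zero] at hz1; linarith
  have harg : z.arg ∈ Set.Icc (0:ℝ) (2 * Real.pi / 3) := by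
    refine ⟨Complex.arg_nonneg_iff.2 him, ?_⟩
    by_contra hcon
    push Not at hcon
    have h1 : Real.cos z.arg < Real.cos (2 * Real.pi / 3) :=
      Real.cos_lt_cos_of_nonneg_of_le_pi (by positivity) (Complex.arg_le_pi z) hcon
    have hc23 : Real.cos (2 * Real.pi / 3) = -(1 / 2) := by
      rw [show 2 * Real.pi / 3 = Real.pi - Real.pi / 3 by ring, Real.cos_pi_sub,
        Real.cos_pi_div_three]
    rw [hc23, Complex.cos_arg hz0, div_lt_iff₀ (by linarith)] at h1
    linarith
  have := h ‖z‖ ((le_max_left _ _).trans hz) z.arg harg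
  rwa [Complex.norm_mul_exp_arg_mul_I] at this

lemma decay_final (n : ℕ) (b : ℝ) (μ : ℂ) (v : ℂ → ℂ) (hv : Differentiable ℂ v)
    (hode : ∀ z, deriv (deriv v) z + 2 * (z ^ 2 - b) * deriv v z
      + (2 * ((n : ℂ) + 2) * z + μ) * v z = 0)
    (g0 : RayGrowth b v) (g1 : RayGrowth b (deriv v))
    (g0' : RayGrowth b (fun z => (starRingEnd ℂ) (v ((starRingEnd ℂ) z))))
    (g1' : RayGrowth b (fun z => (starRingEnd ℂ) (deriv v ((starRingEnd ℂ) z)))) :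
    ∃ K : ℝ, (∀ z : ℂ, 0 ≤ z.re → ‖v z‖ ≤ K / (1 + ‖z‖) ^ (n + 2)) ∧
      (∀ z : ℂ, 0 ≤ z.re → ‖deriv v z‖ ≤ K / (1 + ‖z‖) ^ (n + 3)) ∧
      (∀ z : ℂ, 0 ≤ z.re → ‖deriv (deriv v) z‖ ≤ K / (1 + ‖z‖) ^ (n + 2)) := by
  obtain ⟨R1, K1, hb1⟩ := sector_bound n b μ v hv hode g0 g1
  set w : ℂ → ℂ := fun z => (starRingEnd ℂ) (v ((starRingEnd ℂ) z)) with hw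
  obtain ⟨hw1, hwode⟩ := conj_ode n b μ v hode w hw
  have hwd : Differentiable ℂ w := by
    intro z
    have h := (hv ((starRingEnd ℂ) z)).conj_conj
    rw [Complex.conj_conj] at h
    exact h
  have hw1' : deriv w = fun z => (starRingEnd ℂ) (deriv v ((starRingEnd ℂ) z)) := funext hw1
  obtain ⟨R2, K2, hb2⟩ := sector_bound n b _ w hwd hwode g0' (by rw [hw1']; exact g1')
  set R : ℝ := max (max R1 R2) 10 with hR
  have hR10 : 10 ≤ R := le_max_right _ _
  have hbig : ∀ z : ℂ, R ≤ ‖z‖ → -(‖z‖ / 2) ≤ z.re → ‖z ^ (n + 2) * v z‖ ≤ max K1 K2 := by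
    intro z hz hre
    have hR1 : max R1 1 ≤ ‖z‖ := by
      refine max_le ?_ (by linarith)
      exact (le_max_left _ _).trans ((le_max_left _ _).trans hz)
    have hR2 : max R2 1 ≤ ‖z‖ := by
      refine max_le ?_ (by linarith)
      exact (le_max_right _ _).trans ((le_max_left _ _).trans hz)
    rcases le_total 0 z.im with him | him
    · exact (half_bound n v R1 K1 hb1 z hR1 hre him).trans (le_max_left _ _)
    · have := half_bound n w R2 K2 hb2 ((starRingEnd ℂ) z) (by simpa using hR2) (by simpa using hre)
        (by simpa using him)
      refine le_trans (le_of_eq ?_) (this.trans (le_max_right _ _))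
      rw [norm_mul, norm_mul, norm_pow, norm_pow]
      simp [hw]
  -- compact part
  obtain ⟨K3, hK3⟩ := (isCompact_closedBall (0:ℂ) R).exists_bound_of_continuousOn
    hv.continuous.continuousOn
  set L : ℝ := |max K1 K2| * 2 ^ (n + 2) + |K3| * (1 + R) ^ (n + 2) with hL
  have hL0 : 0 ≤ L := by positivity
  have hall : ∀ z : ℂ, (‖z‖ ≤ R ∨ -(‖z‖ / 2) ≤ z.re) → ‖v z‖ ≤ L / (1 + ‖z‖) ^ (n + 2) := by
    intro z hz
    rw [le_div_iff₀ (by positivity)]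
    rcases le_or_gt ‖z‖ R with h | h
    · have h1 := hK3 z (by simpa using h)
      calc ‖v z‖ * (1 + ‖z‖) ^ (n + 2) ≤ |K3| * (1 + R) ^ (n + 2) := by
            gcongr
            exact h1.trans (le_abs_self _)
        _ ≤ L := by rw [hL]; linarith [(by positivity : 0 ≤ |max K1 K2| * 2 ^ (n + 2))]
    · have h1 := hbig z h.le (hz.resolve_left (by linarith))
      rw [norm_mul, norm_pow] at h1
      calc ‖v z‖ * (1 + ‖z‖) ^ (n + 2) ≤ ‖v z‖ * (2 * ‖z‖) ^ (n + 2) := by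
            gcongr; linarith
        _ = (‖z‖ ^ (n + 2) * ‖v z‖) * 2 ^ (n + 2) := by ring
        _ ≤ |max K1 K2| * 2 ^ (n + 2) := by gcongr; exact h1.trans (le_abs_self _)
        _ ≤ L := by
          rw [hL]; linarith [(by positivity : 0 ≤ |K3| * (1 + R) ^ (n + 2))]
  have hdisc : ∀ z : ℂ, 0 ≤ z.re → ∀ w ∈ Metric.sphere z ((1 + ‖z‖) / 8),
      ‖v w‖ ≤ L * (8 / 7) ^ (n + 2) / (1 + ‖z‖) ^ (n + 2) := by
    intro z hz w hw
    have hd : ‖w - z‖ = (1 + ‖z‖) / 8 := by simpa [dist_eq_norm] using hw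
    have hup : ‖w‖ ≤ ‖z‖ + (1 + ‖z‖) / 8 := by
      have := norm_le_norm_add_norm_sub' w z
      linarith
    have hlo : ‖z‖ - (1 + ‖z‖) / 8 ≤ ‖w‖ := by
      have := norm_le_norm_add_norm_sub' z w
      rw [norm_sub_rev] at this
      linarith
    have hre : z.re - (1 + ‖z‖) / 8 ≤ w.re := by
      have := (abs_le.1 (Complex.abs_re_le_norm (w - z))).1
      rw [Complex.sub_re] at this
      linarith
    have h1 := hall w (by
      rcases le_or_gt ‖z‖ 8 with h | h
      · left; linarith
      · right; linarith)
    refine h1.trans ?_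
    have h2 : (7 / 8) * (1 + ‖z‖) ≤ 1 + ‖w‖ := by linarith
    calc L / (1 + ‖w‖) ^ (n + 2) ≤ L / ((7 / 8) * (1 + ‖z‖)) ^ (n + 2) := by gcongr
      _ = _ := by
        rw [mul_pow, div_pow, div_pow]; field_simp
  have hpos : ∀ z : ℂ, 0 < (1 + ‖z‖) / 8 := fun z => by positivity
  refine ⟨L * (8 / 7) ^ (n + 2) * 128, ?_, ?_, ?_⟩
  · intro z hz
    refine (hall z (Or.inr (by linarith [norm_nonneg z]))).trans ?_
    gcongr
    have : (1:ℝ) ≤ (8 / 7) ^ (n + 2) := one_le_pow₀ (by norm_num)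
    nlinarith
  · intro z hz
    have h := Complex.norm_iteratedDeriv_le_of_forall_mem_sphere_norm_le 1 (hpos z)
      hv.diffContOnCl (hdisc z hz)
    rw [iteratedDeriv_one] at h
    refine h.trans ?_
    have hz0 := norm_nonneg z
    have : (Nat.factorial 1 : ℝ) * (L * (8 / 7) ^ (n + 2) / (1 + ‖z‖) ^ (n + 2)) /
        ((1 + ‖z‖) / 8) ^ 1 = L * (8 / 7) ^ (n + 2) * 8 / (1 + ‖z‖) ^ (n + 3) := by
      simp only [Nat.factorial_one, Nat.cast_one, pow_one, one_mul]
      rw [div_div_eq_mul_div, div_mul_eq_mul_div, div_div, ← pow_succ]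
    rw [this]
    gcongr
    norm_num
  · intro z hz
    have h := Complex.norm_iteratedDeriv_le_of_forall_mem_sphere_norm_le 2 (hpos z)
      hv.diffContOnCl (hdisc z hz)
    rw [iteratedDeriv_succ, iteratedDeriv_one] at h
    refine h.trans ?_
    have hz0 := norm_nonneg z
    have : (Nat.factorial 2 : ℝ) * (L * (8 / 7) ^ (n + 2) / (1 + ‖z‖) ^ (n + 2)) /
        ((1 + ‖z‖) / 8) ^ 2 = L * (8 / 7) ^ (n + 2) * 128 / (1 + ‖z‖) ^ (n + 2) /
          (1 + ‖z‖) ^ 2 := by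
      simp only [Nat.factorial_two]
      push_cast
      field_simp
      norm_num
      ring
    rw [this]
    exact div_le_self (by positivity) (one_le_pow₀ (by linarith))

lemma iter_hasDerivAt (g : ℂ → ℂ) (hg : Differentiable ℂ g) (k : ℕ) (z : ℂ) :
    HasDerivAt (iteratedDeriv k g) (iteratedDeriv (k + 1) g z) z := by
  rw [iteratedDeriv_succ]
  have h : ContDiff ℂ (k + 1 : ℕ) g := hg.contDiff
  exact ((h.differentiable_iteratedDeriv k (by exact_mod_cast Nat.lt_succ_self k)) z).hasDerivAt

lemma ladder (J b μ : ℂ) (g : ℂ → ℂ) (hg : Differentiable ℂ g)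
    (hode : ∀ z, deriv (deriv g) z + 2 * (z ^ 2 - b) * deriv g z
      + (2 * (1 - J) * z + μ) * g z = 0) (k : ℕ) :
    ∀ z, iteratedDeriv (k + 2) g z + 2 * (z ^ 2 - b) * iteratedDeriv (k + 1) g z
      + (2 * (2 * k + 1 - J) * z + μ) * iteratedDeriv k g z
      + 2 * (k - J) * (k * iteratedDeriv (k - 1) g z) = 0 := by
  induction k with
  | zero =>
    intro z
    have := hode z
    simp only [zero_add, iteratedDeriv_one, iteratedDeriv_zero, Nat.cast_zero, zero_mul, mul_zero,
      add_zero]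
    rw [iteratedDeriv_succ, iteratedDeriv_one]
    exact this
  | succ k ih =>
    intro z
    have h0 : HasDerivAt (fun z => (k : ℂ) * iteratedDeriv (k - 1) g z)
        ((k : ℂ) * iteratedDeriv k g z) z := by
      rcases k with _ | k
      · simpa using hasDerivAt_const z (0 : ℂ)
      · exact (iter_hasDerivAt g hg k z).const_mul _
    have h1 : HasDerivAt (fun z : ℂ => 2 * (z ^ 2 - b)) (2 * (2 * z)) z := by
      refine (((hasDerivAt_pow 2 z).sub_const b).const_mul 2).congr_deriv ?_
      simp
    have h2 : HasDerivAt (fun z : ℂ => 2 * (2 * (k : ℂ) + 1 - J) * z + μ)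
        (2 * (2 * (k : ℂ) + 1 - J)) z := by
      simpa using ((hasDerivAt_id z).const_mul (2 * (2 * (k : ℂ) + 1 - J))).add_const μ
    have h3 := (((iter_hasDerivAt g hg (k + 2) z).add (h1.mul (iter_hasDerivAt g hg (k + 1) z))).add
      (h2.mul (iter_hasDerivAt g hg k z))).add (h0.const_mul (2 * ((k : ℂ) - J)))
    have h4 := h3.unique ((hasDerivAt_const z (0 : ℂ)).congr_of_eventuallyEq
      (Eventually.of_forall fun w => ih w))
    simp only [Nat.add_sub_cancel]
    push_cast
    linear_combination h4

lemma ladder_growth (J μ : ℂ) (b : ℝ) (g : ℂ → ℂ)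
    (hl : ∀ (k : ℕ) (z : ℂ), iteratedDeriv (k + 2) g z + 2 * (z ^ 2 - b) * iteratedDeriv (k + 1) g z
      + (2 * (2 * k + 1 - J) * z + μ) * iteratedDeriv k g z
      + 2 * (k - J) * (k * iteratedDeriv (k - 1) g z) = 0)
    (h0 : RayGrowth b g) (h1 : RayGrowth b (deriv g)) (k : ℕ) :
    RayGrowth b (iteratedDeriv k g) := by
  induction k using Nat.strong_induction_on with
  | _ k ih =>
    rcases k with _ | _ | k
    · simpa using h0
    · simpa using h1
    · have e : iteratedDeriv (k + 2) g = fun z => ((-2) * (z ^ 2 * iteratedDeriv (k + 1) g z)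
          + (2 * b) * iteratedDeriv (k + 1) g z)
          + ((-(2 * (2 * k + 1 - J))) * (z * iteratedDeriv k g z) + (-μ) * iteratedDeriv k g z)
          + (-(2 * (k - J) * k)) * iteratedDeriv (k - 1) g z := by
        funext z
        linear_combination hl k z
      rw [show k + 1 + 1 = k + 2 from rfl, e]
      have a1 := ih (k + 1) (by omega)
      have a0 := ih k (by omega)
      have am := ih (k - 1) (by omega)
      exact ((((a1.pow_mul 2).const_mul _).add (a1.const_mul _)).add
        ((a0.id_mul.const_mul _).add (a0.const_mul _))).add (am.const_mul _)

lemma poly_of_iteratedDeriv_zero (g : ℂ → ℂ) (hg : Differentiable ℂ g) (n : ℕ)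
    (h : ∀ z, iteratedDeriv n g z = 0) : ∃ p : Polynomial ℂ, ∀ z, g z = p.eval z := by
  have hk : ∀ j : ℕ, iteratedDeriv (n + j) g = fun _ => 0 := by
    intro j
    induction j with
    | zero => funext z; exact h z
    | succ j ih =>
      rw [← add_assoc, iteratedDeriv_succ, ih]
      funext z
      simp
  refine ⟨∑ k ∈ Finset.range n, Polynomial.C ((k.factorial : ℂ)⁻¹ * iteratedDeriv k g 0) *
    Polynomial.X ^ k, fun z => ?_⟩
  rw [← Complex.taylorSeries_eq_of_entire' 0 z hg, tsum_eq_sum (s := Finset.range n)]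
  · simp [Polynomial.eval_finset_sum]
  · intro k hkn
    have : n ≤ k := by simpa using hkn
    obtain ⟨j, rfl⟩ := Nat.exists_eq_add_of_le this
    rw [hk j]; simp

/-- polynomial bound on the ray for a decaying solution and its derivative -/
lemma ray_poly_bound (J b lam : ℂ) (y : ℂ → ℂ) (hd : Differentiable ℂ y)
    (hode : SatisfiesQuarticODE J b lam y)
    (ht : Tendsto (fun r : ℝ => y (r * rayDir)) atTop (nhds 0)) :
    ∃ C : ℝ, 0 ≤ C ∧ ∀ r : ℝ, 1 ≤ r → ‖y (r * rayDir)‖ ≤ C ∧ ‖deriv y (r * rayDir)‖ ≤ C * r ^ 4 := by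
  have hd' : Differentiable ℂ (deriv y) := fun z =>
    ((hd.contDiff (n := 2)).differentiable_deriv_two z)
  have hZd : ∀ r : ℝ, HasDerivAt (fun r : ℝ => (r : ℂ) * rayDir) rayDir r := by
    intro r
    simpa using (Complex.ofRealCLM.hasDerivAt (x := r)).mul_const rayDir
  have hZn : ∀ r : ℝ, 1 ≤ r → ‖(r : ℂ) * rayDir‖ = r := by
    intro r hr
    rw [norm_mul, rayDir_norm, mul_one, Complex.norm_real, Real.norm_eq_abs,
      abs_of_nonneg (by linarith)]
  have hMex : ∃ M : ℝ, 0 ≤ M ∧ ∀ r : ℝ, 1 ≤ r → ‖y (r * rayDir)‖ ≤ M := by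
    have h1 : ∀ᶠ r : ℝ in atTop, ‖y (r * rayDir)‖ < 1 := by
      have := ht.norm
      rw [norm_zero] at this
      exact this.eventually (gt_mem_nhds one_pos)
    obtain ⟨R, hR⟩ := eventually_atTop.1 h1
    have hc : Continuous (fun r : ℝ => y (r * rayDir)) :=
      hd.continuous.comp (Complex.continuous_ofReal.mul continuous_const)
    obtain ⟨M, hM⟩ := (isCompact_Icc (a := (1:ℝ)) (b := R)).exists_bound_of_continuousOn
      hc.continuousOn
    refine ⟨max M 1, by positivity, fun r hr => ?_⟩
    rcases le_total r R with h | h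
    · exact (hM r ⟨hr, h⟩).trans (le_max_left _ _)
    · exact (hR r h).le.trans (le_max_right _ _)
  obtain ⟨M, hM0, hM⟩ := hMex
  set Q : ℝ := 1 + 2 * ‖b‖ + 2 * ‖J‖ + ‖lam‖ with hQ
  have hQ0 : 0 ≤ Q := by positivity
  have hy2 : ∀ r : ℝ, 1 ≤ r → ‖deriv (deriv y) (r * rayDir)‖ ≤ Q * r ^ 4 * M := by
    intro r hr
    set z : ℂ := (r : ℂ) * rayDir with hz
    have hzn : ‖z‖ = r := hZn r hr
    have e : deriv (deriv y) z = (z ^ 4 - 2 * b * z ^ 2 + 2 * J * z - lam) * y z := by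
      linear_combination -(hode z)
    rw [e, norm_mul]
    have h1 : ‖z ^ 4 - 2 * b * z ^ 2 + 2 * J * z - lam‖ ≤
        r ^ 4 + 2 * ‖b‖ * r ^ 2 + 2 * ‖J‖ * r + ‖lam‖ := by
      refine (norm_sub_le _ _).trans ?_
      gcongr
      refine (norm_add_le _ _).trans ?_
      have e2 : ‖2 * J * z‖ = 2 * ‖J‖ * r := by
        rw [norm_mul, norm_mul, hzn]; simp
      have e3 : ‖2 * b * z ^ 2‖ = 2 * ‖b‖ * r ^ 2 := by
        rw [norm_mul, norm_mul, norm_pow, hzn]; simp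
      have e4 : ‖z ^ 4‖ = r ^ 4 := by rw [norm_pow, hzn]
      have := norm_sub_le (z ^ 4) (2 * b * z ^ 2)
      rw [e3, e4] at this
      rw [e2]
      linarith
    have h2 : r ^ 4 + 2 * ‖b‖ * r ^ 2 + 2 * ‖J‖ * r + ‖lam‖ ≤ Q * r ^ 4 := by
      have a1 : r ^ 2 ≤ r ^ 4 := pow_le_pow_right₀ hr (by norm_num)
      have a2 : r ≤ r ^ 4 := le_self_pow₀ hr (by norm_num)
      have a3 : 1 ≤ r ^ 4 := one_le_pow₀ hr
      have b1 : 2 * ‖b‖ * r ^ 2 ≤ 2 * ‖b‖ * r ^ 4 := by gcongr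
      have b2 : 2 * ‖J‖ * r ≤ 2 * ‖J‖ * r ^ 4 := by gcongr
      have b3 : ‖lam‖ * 1 ≤ ‖lam‖ * r ^ 4 := by gcongr
      rw [hQ]
      linarith
    have := hM r hr
    gcongr
    exact h1.trans h2
  refine ⟨2 * M + 16 * Q * M, by positivity, fun r hr => ⟨(hM r hr).trans ?_, ?_⟩⟩
  · have : 0 ≤ 16 * Q * M := by positivity
    linarith
  have hu1 : ∀ t : ℝ, HasDerivAt (fun t : ℝ => y (t * rayDir)) (deriv y (t * rayDir) * rayDir) t :=
    fun t => (hd _).hasDerivAt.comp t (hZd t)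
  have hu2 : ∀ t : ℝ, HasDerivAt (fun t : ℝ => deriv y (t * rayDir) * rayDir)
      (deriv (deriv y) (t * rayDir) * rayDir * rayDir) t :=
    fun t => ((hd' _).hasDerivAt.comp t (hZd t)).mul_const rayDir
  have hI : Convex ℝ (Set.Icc r (r + 1)) := convex_Icc _ _
  have hl : r ∈ Set.Icc r (r + 1) := ⟨le_refl _, by linarith⟩
  have hrr : r + 1 ∈ Set.Icc r (r + 1) := ⟨by linarith, le_refl _⟩
  have hB : ∀ t ∈ Set.Icc r (r + 1), ‖deriv y (t * rayDir) * rayDir - deriv y (r * rayDir) * rayDir‖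
      ≤ Q * (2 * r) ^ 4 * M := by
    intro t htm
    have h := hI.norm_image_sub_le_of_norm_hasDerivWithin_le
      (f := fun t : ℝ => deriv y (t * rayDir) * rayDir)
      (f' := fun t => deriv (deriv y) (t * rayDir) * rayDir * rayDir)
      (C := Q * (2 * r) ^ 4 * M) (fun x _ => (hu2 x).hasDerivWithinAt) (fun x hx => by
        rw [norm_mul, norm_mul, rayDir_norm, mul_one, mul_one]
        have hx1 : 1 ≤ x := hr.trans hx.1
        refine (hy2 x hx1).trans ?_
        gcongr
        linarith [hx.2]) hl htm
    refine h.trans ?_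
    have h3 : ‖t - r‖ ≤ 1 := by
      rw [Real.norm_eq_abs, abs_of_nonneg (by linarith [htm.1])]
      linarith [htm.2]
    exact mul_le_of_le_one_right (by positivity) h3
  have h := hI.norm_image_sub_le_of_norm_hasDerivWithin_le
      (f := fun t : ℝ => y (t * rayDir) - (t : ℂ) * (deriv y (r * rayDir) * rayDir))
      (f' := fun t => deriv y (t * rayDir) * rayDir - deriv y (r * rayDir) * rayDir)
      (C := Q * (2 * r) ^ 4 * M) (fun x _ => by
        have h1 := (Complex.ofRealCLM.hasDerivAt (x := x)).mul_const (deriv y (r * rayDir) * rayDir)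
        have h2 := (hu1 x).sub h1
        refine (h2.congr_deriv ?_).hasDerivWithinAt
        simp) hB hl hrr
  simp only [add_sub_cancel_left, norm_one, mul_one] at h
  set D : ℂ := deriv y (r * rayDir) * rayDir with hD
  have hDn : ‖D‖ = ‖deriv y (r * rayDir)‖ := by rw [hD, norm_mul, rayDir_norm, mul_one]
  have e : D = y (((r + 1 : ℝ) : ℂ) * rayDir) - y (r * rayDir) -
      (y (((r + 1 : ℝ) : ℂ) * rayDir) - ((r + 1 : ℝ) : ℂ) * D - (y (r * rayDir) - (r : ℂ) * D)) := by
    push_cast; ring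
  have h5 : ‖D‖ ≤ M + M + Q * (2 * r) ^ 4 * M := by
    rw [e]
    refine (norm_sub_le _ _).trans (add_le_add ((norm_sub_le _ _).trans ?_) h)
    exact add_le_add (hM _ (by linarith)) (hM _ hr)
  rw [← hDn]
  refine h5.trans ?_
  have a3 : 1 ≤ r ^ 4 := one_le_pow₀ hr
  have : M * 1 ≤ M * r ^ 4 := by gcongr
  nlinarith

lemma exp_ray_norm (b r : ℝ) :
    ‖Complex.exp (-(((r : ℂ) * rayDir) ^ 3 / 3 - b * ((r : ℂ) * rayDir)))‖ =
      Real.exp (r ^ 3 / 3 + b * r / 2) := by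
  rw [Complex.norm_exp]
  congr 1
  have : -(((r : ℂ) * rayDir) ^ 3 / 3 - b * ((r : ℂ) * rayDir)) =
      ((r ^ 3 / 3 : ℝ) : ℂ) + ((b * r : ℝ) : ℂ) * rayDir := by
    have h3 := rayDir_cube
    push_cast
    linear_combination (-(r:ℂ) ^ 3 / 3) * h3
  rw [this, Complex.add_re, Complex.ofReal_re, Complex.re_ofReal_mul, rayDir_re]
  ring

lemma gauge_facts (J : ℂ) (b : ℝ) (lam : ℂ) (y : ℂ → ℂ) (hd : Differentiable ℂ y)
    (hode : SatisfiesQuarticODE J b lam y)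
    (ht : Tendsto (fun r : ℝ => y (r * rayDir)) atTop (nhds 0))
    (g : ℂ → ℂ) (hg : g = fun z => y z * Complex.exp (-(z ^ 3 / 3 - b * z))) :
    Differentiable ℂ g ∧
    (∀ (k : ℕ) (z : ℂ), iteratedDeriv (k + 2) g z + 2 * (z ^ 2 - b) * iteratedDeriv (k + 1) g z
      + (2 * (2 * k + 1 - J) * z + ((b : ℂ) ^ 2 + lam)) * iteratedDeriv k g z
      + 2 * (k - J) * (k * iteratedDeriv (k - 1) g z) = 0) ∧
    ∀ k : ℕ, RayGrowth b (iteratedDeriv k g) := by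
  have hd' : Differentiable ℂ (deriv y) := fun z =>
    ((hd.contDiff (n := 2)).differentiable_deriv_two z)
  have hE : ∀ z : ℂ, HasDerivAt (fun z : ℂ => Complex.exp (-(z ^ 3 / 3 - b * z)))
      (-(z ^ 2 - b) * Complex.exp (-(z ^ 3 / 3 - b * z))) z := by
    intro z
    have h1 : HasDerivAt (fun z : ℂ => -(z ^ 3 / 3 - b * z)) (-(z ^ 2 - b)) z := by
      refine ((((hasDerivAt_pow 3 z).div_const 3).sub
        ((hasDerivAt_id z).const_mul (b : ℂ))).neg).congr_deriv ?_
      simp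
    refine h1.cexp.congr_deriv ?_
    ring
  have hg1 : ∀ z, HasDerivAt g
      ((deriv y z - (z ^ 2 - b) * y z) * Complex.exp (-(z ^ 3 / 3 - b * z))) z := by
    intro z
    rw [hg]
    refine ((hd z).hasDerivAt.mul (hE z)).congr_deriv ?_
    ring
  have hgd : Differentiable ℂ g := fun z => (hg1 z).differentiableAt
  have hg1' : deriv g = fun z =>
      (deriv y z - (z ^ 2 - b) * y z) * Complex.exp (-(z ^ 3 / 3 - b * z)) :=
    funext fun z => (hg1 z).deriv
  have hg2 : ∀ z, deriv (deriv g) z = (deriv (deriv y) z - 2 * (z ^ 2 - b) * deriv y z +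
      ((z ^ 2 - b) ^ 2 - 2 * z) * y z) * Complex.exp (-(z ^ 3 / 3 - b * z)) := by
    intro z
    rw [hg1']
    have h1 : HasDerivAt (fun z : ℂ => z ^ 2 - (b : ℂ)) (2 * z) z := by
      refine ((hasDerivAt_pow 2 z).sub_const (b : ℂ)).congr_deriv ?_
      simp
    have h2 := (((hd' z).hasDerivAt.sub (h1.mul (hd z).hasDerivAt)).mul (hE z)).deriv
    refine Eq.trans h2 ?_
    simp only [Pi.sub_apply, Pi.mul_apply]
    ring
  have hgode : ∀ z, deriv (deriv g) z + 2 * (z ^ 2 - b) * deriv g z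
      + (2 * (1 - J) * z + ((b : ℂ) ^ 2 + lam)) * g z = 0 := by
    intro z
    rw [hg2, hg1', hg]
    have := hode z
    simp only
    linear_combination (-Complex.exp (-(z ^ 3 / 3 - b * z))) * this
  have hl := ladder J b _ g hgd hgode
  refine ⟨hgd, hl, ?_⟩
  obtain ⟨C, hC, hb⟩ := ray_poly_bound J b lam y hd hode ht
  have r0 : RayGrowth b g := by
    refine ⟨C, 0, hC, fun r hr => ?_⟩
    rw [hg]
    simp only [pow_zero, mul_one]
    rw [norm_mul, exp_ray_norm]
    gcongr
    exact (hb r hr).1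
  have r1 : RayGrowth b (fun z => deriv y z * Complex.exp (-(z ^ 3 / 3 - b * z))) := by
    refine ⟨C, 4, hC, fun r hr => ?_⟩
    rw [norm_mul, exp_ray_norm]
    gcongr
    exact (hb r hr).2
  have r2 : RayGrowth b (deriv g) := by
    have := (r1.add ((r0.pow_mul 2).const_mul (-1))).add (r0.const_mul (b : ℂ))
    convert this using 1
    rw [hg1', hg]
    funext z
    ring
  exact ladder_growth J _ b g hl r0 r2

lemma iter_conj (g : ℂ → ℂ) (k : ℕ) :
    iteratedDeriv k (fun z => (starRingEnd ℂ) (g ((starRingEnd ℂ) z))) =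
      fun z => (starRingEnd ℂ) (iteratedDeriv k g ((starRingEnd ℂ) z)) := by
  induction k with
  | zero => simp
  | succ k ih =>
    rw [iteratedDeriv_succ, ih, iteratedDeriv_succ]
    exact deriv_conj_conj (f := iteratedDeriv k g)

theorem non_qes_eigenvalues_real (J : ℕ) (hJ : 0 < J) (b : ℝ) (lam : ℂ)
    (hev : IsQuarticEigenvalue (J : ℂ) (b : ℂ) lam)
    (hqes : ((b : ℂ), lam) ∉ qesSpectralLocus (J : ℂ)) :
    lam.im = 0 := by
  obtain ⟨y, hd, hy0, hode, ht1, ht2⟩ := hev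
  by_contra him
  set g : ℂ → ℂ := fun z => y z * Complex.exp (-(z ^ 3 / 3 - b * z)) with hg
  have hray : Complex.exp (Complex.I * (Real.pi / 3)) = rayDir := by
    unfold rayDir; congr 1; push_cast; ring
  have hray2 : Complex.exp (-Complex.I * (Real.pi / 3)) = (starRingEnd ℂ) rayDir := by
    unfold rayDir
    rw [← Complex.exp_conj]
    congr 1
    rw [map_mul, Complex.conj_ofReal, Complex.conj_I]
    push_cast; ring
  rw [hray] at ht1
  rw [hray2] at ht2
  obtain ⟨hgd, hl, hgr⟩ := gauge_facts J b lam y hd hode ht1 g hg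
  -- the reflected problem
  set y' : ℂ → ℂ := fun z => (starRingEnd ℂ) (y ((starRingEnd ℂ) z)) with hy'
  have hy'c : y' = (starRingEnd ℂ) ∘ y ∘ (starRingEnd ℂ) := rfl
  have hd' : Differentiable ℂ y' := by
    intro z
    have h := (hd ((starRingEnd ℂ) z)).conj_conj
    rw [Complex.conj_conj] at h
    exact h
  have hode' : SatisfiesQuarticODE (J : ℂ) (b : ℂ) ((starRingEnd ℂ) lam) y' := by
    intro z
    have h2 : deriv (deriv y') z = (starRingEnd ℂ) (deriv (deriv y) ((starRingEnd ℂ) z)) := by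
      rw [hy'c, deriv_conj_conj, deriv_conj_conj]; rfl
    rw [h2]
    have h3 := congrArg (starRingEnd ℂ) (hode ((starRingEnd ℂ) z))
    simpa [Complex.conj_ofNat, hy'] using h3
  have ht' : Tendsto (fun r : ℝ => y' (r * rayDir)) atTop (nhds 0) := by
    have h := (Complex.continuous_conj.tendsto 0).comp ht2
    rw [map_zero] at h
    refine h.congr fun r => ?_
    simp [hy']
  set g' : ℂ → ℂ := fun z => (starRingEnd ℂ) (g ((starRingEnd ℂ) z)) with hg'
  have hg'e : g' = fun z => y' z * Complex.exp (-(z ^ 3 / 3 - b * z)) := by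
    funext z
    simp only [hg', hg, hy', map_mul, ← Complex.exp_conj, map_neg, map_sub, map_div₀, map_pow,
      Complex.conj_conj, Complex.conj_ofReal, Complex.conj_ofNat]
  obtain ⟨-, -, hgr'⟩ := gauge_facts J b _ y' hd' hode' ht' g' hg'e
  obtain ⟨n, rfl⟩ : ∃ n, J = n + 1 := ⟨J - 1, by omega⟩
  set v : ℂ → ℂ := iteratedDeriv (n + 1) g with hv
  have hvd : Differentiable ℂ v := fun z => (iter_hasDerivAt g hgd (n + 1) z).differentiableAt
  have hdv : deriv v = iteratedDeriv (n + 2) g := by rw [hv, ← iteratedDeriv_succ]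
  have hddv : deriv (deriv v) = iteratedDeriv (n + 3) g := by
    rw [hdv, ← iteratedDeriv_succ]
  have hvode : ∀ z, deriv (deriv v) z + 2 * (z ^ 2 - b) * deriv v z
      + (2 * ((n : ℂ) + 2) * z + ((b : ℂ) ^ 2 + lam)) * v z = 0 := by
    intro z
    have := hl (n + 1) z
    rw [hddv, hdv]
    push_cast at this
    rw [show n + 1 + 2 = n + 3 from rfl, show n + 1 + 1 = n + 2 from rfl] at this
    linear_combination this
  obtain ⟨K, k0, k1, k2⟩ := decay_final n b _ v hvd hvode (hgr (n + 1))
    (by rw [hdv]; exact hgr (n + 2))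
    (by have := hgr' (n + 1); rwa [hg', iter_conj] at this)
    (by have := hgr' (n + 2); rw [hg', iter_conj] at this; rw [hdv]; exact this)
  have hμ : ((b : ℂ) ^ 2 + lam).im ≠ 0 := by
    rw [Complex.add_im, ← Complex.ofReal_pow, Complex.ofReal_im, zero_add]
    exact him
  have hv0 := final_argument n b _ hμ v hvd hvode K k0 k1 k2
  obtain ⟨p, hp⟩ := poly_of_iteratedDeriv_zero g hgd (n + 1) hv0
  have hyq : y = qesFun b p := by
    funext z
    unfold qesFun
    rw [← hp z, hg]
    simp only
    rw [mul_assoc, ← Complex.exp_add, neg_add_cancel, Complex.exp_zero, mul_one]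
  apply hqes
  refine ⟨p, ?_, ?_⟩
  · rintro rfl
    apply hy0
    rw [hyq]
    funext z
    simp [qesFun]
  · rw [← hyq]
    exact hode
end

section
/- Let J ∈ ℝ with J ≤ 1 and b ∈ ℝ. Then every eigenvalue λ ∈ ℂ of L_J(b) is real. -/
open Complex Filter Polynomial

/-- super-exponential cubic decay on the half line -/
def Dec (h : ℝ → ℂ) : Prop :=
  Continuous h ∧ ∃ M c : ℝ, ∀ r : ℝ, 0 ≤ r → ‖h r‖ ≤ M * Real.exp (-r ^ 3 / 3 + c * r)

/-- Laplace type transform along the ray of direction `w` -/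
noncomputable def LapT (w : ℂ) (h : ℝ → ℂ) (t : ℂ) : ℂ :=
  ∫ r in Set.Ioi (0 : ℝ), Complex.exp (-(w * r * t)) * h r

lemma cubic_young (r s : ℝ) (hr : 0 ≤ r) (hs : 0 ≤ s) :
    s * r ≤ r ^ 3 / 3 + s ^ (3 / 2 : ℝ) := by
  have hpq : (3 : ℝ).HolderConjugate (3 / 2) := by
    rw [Real.holderConjugate_iff]; norm_num
  have := Real.young_inequality_of_nonneg hr hs hpq
  have h3 : r ^ (3 : ℝ) = r ^ 3 := by exact_mod_cast Real.rpow_natCast r 3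
  rw [h3] at this
  have h4 : 0 ≤ s ^ (3 / 2 : ℝ) := Real.rpow_nonneg hs _
  nlinarith

lemma Dec.mul {h p : ℝ → ℂ} (hh : Dec h) (hp : Continuous p)
    (hb : ∃ A a : ℝ, ∀ r : ℝ, 0 ≤ r → ‖p r‖ ≤ A * Real.exp (a * r)) :
    Dec (fun r => p r * h r) := by
  obtain ⟨hc, M, c, hM⟩ := hh
  obtain ⟨A, a, hA⟩ := hb
  refine ⟨hp.mul hc, A * M, a + c, fun r hr => ?_⟩
  rw [norm_mul]
  calc ‖p r‖ * ‖h r‖ ≤ (A * Real.exp (a * r)) * (M * Real.exp (-r ^ 3 / 3 + c * r)) :=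
        mul_le_mul (hA r hr) (hM r hr) (norm_nonneg _) ((norm_nonneg _).trans (hA r hr))
    _ = A * M * Real.exp (-r ^ 3 / 3 + (a + c) * r) := by
        rw [show -r ^ 3 / 3 + (a + c) * r = a * r + (-r ^ 3 / 3 + c * r) by ring,
          Real.exp_add (a * r)]
        ring

lemma Dec.add {h k : ℝ → ℂ} (hh : Dec h) (hk : Dec k) : Dec (fun r => h r + k r) := by
  obtain ⟨hc, M, c, hM⟩ := hh
  obtain ⟨kc, N, d, hN⟩ := hk
  refine ⟨hc.add kc, |M| + |N|, max c d, fun r hr => ?_⟩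
  have e1 : Real.exp (-r ^ 3 / 3 + c * r) ≤ Real.exp (-r ^ 3 / 3 + max c d * r) := by
    apply Real.exp_le_exp.2
    have := mul_le_mul_of_nonneg_right (le_max_left c d) hr
    linarith
  have e2 : Real.exp (-r ^ 3 / 3 + d * r) ≤ Real.exp (-r ^ 3 / 3 + max c d * r) := by
    apply Real.exp_le_exp.2
    have := mul_le_mul_of_nonneg_right (le_max_right c d) hr
    linarith
  calc ‖h r + k r‖ ≤ ‖h r‖ + ‖k r‖ := norm_add_le _ _
    _ ≤ M * Real.exp (-r ^ 3 / 3 + c * r) + N * Real.exp (-r ^ 3 / 3 + d * r) :=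
        add_le_add (hM r hr) (hN r hr)
    _ ≤ |M| * Real.exp (-r ^ 3 / 3 + max c d * r) + |N| * Real.exp (-r ^ 3 / 3 + max c d * r) := by
        gcongr
        · exact le_abs_self M
        · exact le_abs_self N
    _ = _ := by ring

lemma exp_factor_bound (w t : ℂ) : ∃ A a : ℝ, ∀ r : ℝ, 0 ≤ r →
    ‖Complex.exp (-(w * r * t))‖ ≤ A * Real.exp (a * r) := by
  refine ⟨1, ‖w * t‖, fun r hr => ?_⟩
  rw [Complex.norm_exp, one_mul]
  apply Real.exp_le_exp.2
  calc (-(w * r * t)).re ≤ ‖-(w * r * t)‖ := Complex.re_le_norm _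
    _ = ‖w * t‖ * r := by
      rw [norm_neg, norm_mul, norm_mul, norm_mul, Complex.norm_real, Real.norm_of_nonneg hr]; ring

lemma Dec.mul_exp {h : ℝ → ℂ} (hh : Dec h) (w t : ℂ) :
    Dec (fun r => Complex.exp (-(w * r * t)) * h r) :=
  hh.mul (by fun_prop) (exp_factor_bound w t)

lemma Dec.const_mul {h : ℝ → ℂ} (hh : Dec h) (k : ℂ) : Dec (fun r => k * h r) :=
  hh.mul continuous_const ⟨‖k‖, 0, fun r _ => by simp⟩

lemma Dec.mul_r {h : ℝ → ℂ} (hh : Dec h) (k : ℂ) : Dec (fun r => (k * r) * h r) := by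
  refine hh.mul (by fun_prop) ⟨‖k‖, 1, fun r hr => ?_⟩
  rw [norm_mul, Complex.norm_real, Real.norm_of_nonneg hr, one_mul]
  gcongr
  linarith [Real.add_one_le_exp r]

lemma Dec.bound {h : ℝ → ℂ} (hh : Dec h) (a : ℝ) :
    ∃ M : ℝ, 0 ≤ M ∧ ∀ r : ℝ, 0 ≤ r → ‖h r‖ ≤ M * Real.exp (-a * r) := by
  obtain ⟨hc, M, c, hM⟩ := hh
  refine ⟨|M| * Real.exp (|c + a| ^ (3 / 2 : ℝ)), by positivity, fun r hr => ?_⟩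
  calc ‖h r‖ ≤ M * Real.exp (-r ^ 3 / 3 + c * r) := hM r hr
    _ ≤ |M| * Real.exp (|c + a| ^ (3 / 2 : ℝ) + -a * r) := by
        refine mul_le_mul (le_abs_self M) (Real.exp_le_exp.2 ?_) (Real.exp_nonneg _) (abs_nonneg _)
        have := cubic_young r |c + a| hr (abs_nonneg _)
        have := mul_le_mul_of_nonneg_right (le_abs_self (c + a)) hr
        nlinarith
    _ = _ := by rw [Real.exp_add]; ring

lemma integrableOn_exp_neg : MeasureTheory.IntegrableOn (fun r : ℝ => Real.exp (-1 * r)) (Set.Ioi 0) := by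
  simpa using integrableOn_exp_mul_Ioi (a := -1) (by norm_num) 0

lemma Dec.integrableOn {h : ℝ → ℂ} (hh : Dec h) :
    MeasureTheory.IntegrableOn h (Set.Ioi 0) := by
  obtain ⟨M, _, hM⟩ := hh.bound 1
  refine (integrableOn_exp_neg.const_mul M).mono' hh.1.aestronglyMeasurable ?_
  filter_upwards [MeasureTheory.ae_restrict_mem measurableSet_Ioi] with r hr
  exact hM r (le_of_lt hr)

lemma Dec.tendsto {h : ℝ → ℂ} (hh : Dec h) : Tendsto h atTop (nhds 0) := by
  obtain ⟨M, _, hM⟩ := hh.bound 1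
  have h1 : Tendsto (fun r : ℝ => M * Real.exp (-1 * r)) atTop (nhds 0) := by
    have : Tendsto (fun r : ℝ => Real.exp (-1 * r)) atTop (nhds 0) := by
      simpa using Real.tendsto_exp_neg_atTop_nhds_zero
    simpa using this.const_mul M
  exact squeeze_zero_norm' ((eventually_ge_atTop 0).mono fun r hr => hM r hr) h1

lemma LapT_hasDerivAt {h : ℝ → ℂ} (hh : Dec h) (w t : ℂ) :
    HasDerivAt (LapT w h) (LapT w (fun r => (-w * r) * h r) t) t := by
  obtain ⟨M, hM0, hM⟩ := (hh.mul_r (-w)).bound (‖w‖ * (‖t‖ + 1) + 1)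
  refine (hasDerivAt_integral_of_dominated_loc_of_deriv_le
    (F := fun (t : ℂ) (r : ℝ) => Complex.exp (-(w * r * t)) * h r)
    (F' := fun (t : ℂ) (r : ℝ) => Complex.exp (-(w * r * t)) * ((-w * r) * h r))
    (bound := fun r => M * Real.exp (-1 * r))
    (Metric.ball_mem_nhds t one_pos) ?_ ?_ ?_ ?_ ?_ ?_).2
  · exact Eventually.of_forall fun s => (hh.mul_exp w s).1.aestronglyMeasurable
  · exact (hh.mul_exp w t).integrableOn
  · exact ((hh.mul_r (-w)).mul_exp w t).1.aestronglyMeasurable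
  · filter_upwards [MeasureTheory.ae_restrict_mem measurableSet_Ioi] with r hr s hs
    have hr0 : (0 : ℝ) ≤ r := le_of_lt hr
    rw [norm_mul]
    have hs' : ‖s‖ ≤ ‖t‖ + 1 := by
      have : ‖s - t‖ < 1 := by simpa [dist_eq_norm] using hs
      calc ‖s‖ = ‖t + (s - t)‖ := by ring_nf
        _ ≤ ‖t‖ + ‖s - t‖ := norm_add_le _ _
        _ ≤ _ := by linarith
    have e1 : ‖Complex.exp (-(w * r * s))‖ ≤ Real.exp (‖w‖ * (‖t‖ + 1) * r) := by
      rw [Complex.norm_exp]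
      apply Real.exp_le_exp.2
      calc (-(w * r * s)).re ≤ ‖-(w * r * s)‖ := Complex.re_le_norm _
        _ = ‖w‖ * ‖s‖ * r := by
          rw [norm_neg, norm_mul, norm_mul, Complex.norm_real, Real.norm_of_nonneg hr0]; ring
        _ ≤ _ := by gcongr
    calc _ ≤ Real.exp (‖w‖ * (‖t‖ + 1) * r) * (M * Real.exp (-(‖w‖ * (‖t‖ + 1) + 1) * r)) :=
          mul_le_mul e1 (hM r hr0) (norm_nonneg _) (Real.exp_nonneg _)
      _ = M * (Real.exp (‖w‖ * (‖t‖ + 1) * r) * Real.exp (-(‖w‖ * (‖t‖ + 1) + 1) * r)) := by ring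
      _ = _ := by rw [← Real.exp_add]; ring_nf
  · exact integrableOn_exp_neg.const_mul M
  · filter_upwards with r s _
    have h1 : HasDerivAt (fun s : ℂ => -(w * r * s)) (-(w * r)) s := by
      have h0 : HasDerivAt (fun s : ℂ => w * r * s) (w * r) s := by
        simpa using (hasDerivAt_id s).const_mul (w * r)
      exact h0.neg
    refine ((h1.cexp).mul_const (h r)).congr_deriv ?_
    ring

lemma LapT_bound {h : ℝ → ℂ} (hh : Dec h) (w t : ℂ) (hwt : 0 ≤ (w * t).re) :
    ‖LapT w h t‖ ≤ ∫ r in Set.Ioi (0 : ℝ), ‖h r‖ := by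
  refine MeasureTheory.norm_integral_le_of_norm_le hh.integrableOn.norm ?_
  filter_upwards [MeasureTheory.ae_restrict_mem measurableSet_Ioi] with r hr
  have hr0 : (0 : ℝ) ≤ r := le_of_lt hr
  rw [norm_mul, Complex.norm_exp]
  have : (-(w * r * t)).re ≤ 0 := by
    have : w * r * t = r * (w * t) := by ring
    rw [this, Complex.neg_re, Complex.re_ofReal_mul]
    nlinarith [mul_nonneg hr0 hwt]
  calc _ ≤ 1 * ‖h r‖ := by
        gcongr
        exact Real.exp_le_one_iff.2 this
    _ = _ := one_mul _

lemma LapT_growth {h : ℝ → ℂ} (hh : Dec h) (w : ℂ) :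
    ∃ M R : ℝ, ∀ t : ℂ, R ≤ ‖t‖ →
      ‖LapT w h t‖ ≤ M * Real.exp (((‖w‖ + 1) * ‖t‖) ^ (3 / 2 : ℝ)) := by
  obtain ⟨hc, M, c, hM⟩ := id hh
  refine ⟨∫ r in Set.Ioi (0 : ℝ), |M| * Real.exp (-1 * r), |c| + 1, fun t ht => ?_⟩
  rw [← MeasureTheory.integral_mul_const]
  refine MeasureTheory.norm_integral_le_of_norm_le
    ((integrableOn_exp_neg.const_mul |M|).mul_const _) ?_
  filter_upwards [MeasureTheory.ae_restrict_mem measurableSet_Ioi] with r hr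
  have hr0 : (0 : ℝ) ≤ r := le_of_lt hr
  rw [norm_mul]
  have e1 : ‖Complex.exp (-(w * r * t))‖ ≤ Real.exp (‖w‖ * ‖t‖ * r) := by
    rw [Complex.norm_exp]
    apply Real.exp_le_exp.2
    calc (-(w * r * t)).re ≤ ‖-(w * r * t)‖ := Complex.re_le_norm _
      _ = ‖w‖ * ‖t‖ * r := by
        rw [norm_neg, norm_mul, norm_mul, Complex.norm_real, Real.norm_of_nonneg hr0]; ring
  have hy := cubic_young r ((‖w‖ + 1) * ‖t‖) hr0 (by positivity)
  have hcc : c * r ≤ (‖t‖ - 1) * r := by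
    gcongr
    linarith [le_abs_self c]
  calc _ ≤ Real.exp (‖w‖ * ‖t‖ * r) * (|M| * Real.exp (-r ^ 3 / 3 + c * r)) := by
        refine mul_le_mul e1 ((hM r hr0).trans ?_) (norm_nonneg _) (Real.exp_nonneg _)
        gcongr
        exact le_abs_self M
    _ = |M| * Real.exp (‖w‖ * ‖t‖ * r + (-r ^ 3 / 3 + c * r)) := by
        rw [Real.exp_add (‖w‖ * ‖t‖ * r)]; ring
    _ ≤ |M| * Real.exp (-1 * r + ((‖w‖ + 1) * ‖t‖) ^ (3 / 2 : ℝ)) := by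
        refine mul_le_mul_of_nonneg_left (Real.exp_le_exp.2 ?_) (abs_nonneg _)
        linarith
    _ = _ := by rw [Real.exp_add]; ring

open scoped FourierTransform in
lemma LapT_const_zero {h : ℝ → ℂ} (hh : Dec h) (w : ℂ) (hw : w ≠ 0) (K : ℂ)
    (hK : ∀ t, LapT w h t = K) (r : ℝ) (hr : 0 < r) : h r = 0 := by
  set f : ℝ → ℂ := (Set.Ioi (0 : ℝ)).indicator h with hf
  have hfi : MeasureTheory.Integrable f := by
    rw [hf, MeasureTheory.integrable_indicator_iff measurableSet_Ioi]
    exact hh.integrableOn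
  have hF : ∀ s, 𝓕 f s = K := by
    intro s
    rw [Real.fourier_real_eq_integral_exp_smul, ← hK (2 * Real.pi * s * Complex.I / w), LapT,
      ← MeasureTheory.integral_indicator measurableSet_Ioi]
    congr 1
    ext x
    by_cases hx : x ∈ Set.Ioi (0 : ℝ)
    · rw [hf, Set.indicator_of_mem hx, Set.indicator_of_mem hx, smul_eq_mul]
      congr 2
      push_cast
      field_simp
    · rw [hf, Set.indicator_of_notMem hx, Set.indicator_of_notMem hx, smul_zero]
  have hK0 : K = 0 := by
    have h1 := Real.zero_at_infty_fourier f
    have h2 : 𝓕 f = fun _ => K := funext hF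
    rw [h2] at h1
    exact tendsto_nhds_unique tendsto_const_nhds h1
  have h2 : 𝓕 f = fun _ => 0 := by funext s; rw [hF, hK0]
  have hca : ContinuousAt f r := by
    refine hh.1.continuousAt.congr ?_
    filter_upwards [Ioi_mem_nhds hr] with x hx
    rw [hf, Set.indicator_of_mem hx]
  have h3 := hfi.fourierInv_fourier_eq (by rw [h2]; exact MeasureTheory.integrable_zero _ _ _) hca
  rw [h2] at h3
  have h4 : f r = h r := by rw [hf, Set.indicator_of_mem (Set.mem_Ioi.2 hr)]
  rw [← h4, ← h3, Real.fourierInv_eq']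
  simp

/-- the two ray directions -/
noncomputable def wP : ℂ := ⟨1 / 2, Real.sqrt 3 / 2⟩
noncomputable def wM : ℂ := ⟨1 / 2, -(Real.sqrt 3 / 2)⟩

lemma sqrt3_gt : (1 : ℝ) < Real.sqrt 3 := by
  rw [Real.lt_sqrt] <;> norm_num

lemma sqrt3_sq : Real.sqrt 3 * Real.sqrt 3 = 3 := Real.mul_self_sqrt (by norm_num)

lemma wP_ne : wP ≠ 0 := by
  intro h
  have := congrArg Complex.re h
  simp [wP] at this

lemma rays_zero {h k : ℝ → ℂ} (hh : Dec h) (hk : Dec k)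
    (heq : ∀ t, LapT wP h t = LapT wM k t) (r : ℝ) (hr : 0 < r) : h r = 0 := by
  have hs := sqrt3_gt
  have hdiff : Differentiable ℂ (LapT wP h) := fun t => (LapT_hasDerivAt hh wP t).differentiableAt
  set K : ℝ := max (∫ r in Set.Ioi (0 : ℝ), ‖h r‖) (∫ r in Set.Ioi (0 : ℝ), ‖k r‖) with hK
  have hbP : ∀ t, 0 ≤ (wP * t).re → ‖LapT wP h t‖ ≤ K := fun t ht =>
    (LapT_bound hh wP t ht).trans (le_max_left _ _)
  have hbM : ∀ t, 0 ≤ (wM * t).re → ‖LapT wP h t‖ ≤ K := fun t ht => by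
    rw [heq]
    exact (LapT_bound hk wM t ht).trans (le_max_right _ _)
  set u : ℂ := ⟨-1, 1⟩ with hu
  have hun : ‖u‖ ≠ 0 := by
    rw [norm_ne_zero_iff]
    intro h
    have := congrArg Complex.re h
    simp [hu] at this
  have hquad : ∀ z : ℂ, 0 ≤ z.re → 0 ≤ z.im → ‖LapT wP h (u * z)‖ ≤ K := by
    intro z hz1 hz2
    refine PhragmenLindelof.quadrant_I (f := fun z => LapT wP h (u * z)) (C := K) ?_ ?_ ?_ ?_ hz1 hz2
    · exact (hdiff.comp (by fun_prop : Differentiable ℂ fun z : ℂ => u * z)).diffContOnCl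
    · obtain ⟨M, R, hMR⟩ := LapT_growth hh wP
      refine ⟨3 / 2, by norm_num, ((‖wP‖ + 1) * ‖u‖) ^ (3 / 2 : ℝ), ?_⟩
      refine Asymptotics.IsBigO.of_bound M ?_
      have hev : ∀ᶠ z : ℂ in Bornology.cobounded ℂ, R / ‖u‖ ≤ ‖z‖ :=
        tendsto_norm_cobounded_atTop.eventually (eventually_ge_atTop _)
      filter_upwards [hev.filter_mono inf_le_left] with z hz
      have h1 := hMR (u * z) (by
        rw [norm_mul]
        rw [div_le_iff₀ (by positivity)] at hz
        linarith)
      rw [Real.norm_of_nonneg (Real.exp_nonneg _)]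
      rw [← Real.mul_rpow (by positivity) (by positivity)]
      rw [norm_mul, ← mul_assoc] at h1
      exact h1
    · intro x hx
      apply hbM
      simp [wM, hu]
      nlinarith
    · intro x hx
      apply hbP
      simp [wP, hu]
      nlinarith
  have hall : ∀ t, ‖LapT wP h t‖ ≤ K := by
    intro t
    by_cases h1 : 0 ≤ (wP * t).re
    · exact hbP t h1
    by_cases h2 : 0 ≤ (wM * t).re
    · exact hbM t h2
    have e1 : (wP * t).re = 1 / 2 * t.re - Real.sqrt 3 / 2 * t.im := by simp [wP]
    have e2 : (wM * t).re = 1 / 2 * t.re + Real.sqrt 3 / 2 * t.im := by simp [wM]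
    rw [e1] at h1
    rw [e2] at h2
    push Not at h1 h2
    have e3 : t = u * ⟨(-t.re + t.im) / 2, (-t.re - t.im) / 2⟩ := by
      apply Complex.ext <;> simp [hu] <;> ring
    rw [e3]
    apply hquad
    · change 0 ≤ (-t.re + t.im) / 2
      rcases le_total 0 t.im with h | h <;> nlinarith
    · change 0 ≤ (-t.re - t.im) / 2
      rcases le_total 0 t.im with h | h <;> nlinarith
  have hconst : ∀ t, LapT wP h t = LapT wP h 0 := fun t =>
    hdiff.apply_eq_apply_of_bounded
      ((Metric.isBounded_closedBall (x := (0 : ℂ)) (r := K)).subset (by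
        rintro _ ⟨t, rfl⟩
        simpa using hall t)) t 0
  exact LapT_const_zero hh wP wP_ne _ hconst r hr

/-- decay of the transform along the positive axis, by moving the contour to the right -/
lemma contour_decay {v : ℂ → ℂ} (hv : Differentiable ℂ v)
    (hp : Dec (fun r => v (wP * r))) (hm : Dec (fun r => v (wM * r))) :
    ∃ K : ℝ, ∀ t : ℝ, 0 ≤ t →
      ‖wP * LapT wP (fun r => v (wP * r)) t - wM * LapT wM (fun r => v (wM * r)) t‖
        ≤ K * Real.exp (-t / 2) := by
  obtain ⟨B, hB⟩ : ∃ B, ∀ s ∈ Set.Icc (-(Real.sqrt 3 / 2)) (Real.sqrt 3 / 2),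
      ‖v (⟨1 / 2, s⟩ : ℂ)‖ ≤ B := by
    apply isCompact_Icc.exists_bound_of_continuousOn
    have : (fun s : ℝ => v (⟨1 / 2, s⟩ : ℂ)) = fun s : ℝ => v (1 / 2 + s * Complex.I) := by
      funext s
      congr 1
      apply Complex.ext <;> simp
    rw [this]
    have := hv.continuous
    fun_prop
  set KP := ∫ r in Set.Ioi (1 : ℝ), ‖v (wP * r)‖ with hKP
  set KM := ∫ r in Set.Ioi (1 : ℝ), ‖v (wM * r)‖ with hKM
  refine ⟨B * Real.sqrt 3 + ‖wP‖ * KP + ‖wM‖ * KM, fun t ht => ?_⟩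
  have hF : Differentiable ℂ (fun z => Complex.exp (-(z * t)) * v z) := by fun_prop
  obtain ⟨V, hV⟩ := hF.isExactOn_univ
  replace hV : ∀ z, HasDerivAt V (Complex.exp (-(z * t)) * v z) z := fun z => hV z (Set.mem_univ z)
  have hray : ∀ w : ℂ, w * ∫ r in (0 : ℝ)..1, Complex.exp (-(w * r * t)) * v (w * r) = V w - V 0 := by
    intro w
    rw [← intervalIntegral.integral_const_mul]
    have := intervalIntegral.integral_eq_sub_of_hasDerivAt (a := 0) (b := 1)
      (f := fun r : ℝ => V (w * r))
      (f' := fun r : ℝ => w * (Complex.exp (-(w * r * t)) * v (w * r))) ?_ ?_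
    · rw [this]; simp
    · intro r _
      have h1 : HasDerivAt (fun r : ℝ => w * (r : ℂ)) w r := by
        simpa using (Complex.ofRealCLM.hasDerivAt (x := r)).const_mul w
      have := (hV (w * r)).comp r h1
      exact this.congr_deriv (by ring)
    · apply Continuous.intervalIntegrable
      have := hv.continuous
      fun_prop
  have hsplit : ∀ w : ℂ, Dec (fun r => v (w * r)) → w * LapT w (fun r => v (w * r)) t =
      (V w - V 0) + w * ∫ r in Set.Ioi (1 : ℝ), Complex.exp (-(w * r * t)) * v (w * r) := by
    intro w hw
    rw [← hray w, ← mul_add, LapT]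
    congr 1
    have hi := (hw.mul_exp w t).integrableOn
    rw [intervalIntegral.integral_of_le zero_le_one,
      ← MeasureTheory.setIntegral_union Set.Ioc_disjoint_Ioi_same measurableSet_Ioi
        (hi.mono_set Set.Ioc_subset_Ioi_self) (hi.mono_set (Set.Ioi_subset_Ioi zero_le_one)),
      Set.Ioc_union_Ioi_eq_Ioi zero_le_one]
  have htail : ∀ w : ℂ, w.re = 1 / 2 → Dec (fun r => v (w * r)) →
      ‖∫ r in Set.Ioi (1 : ℝ), Complex.exp (-(w * r * t)) * v (w * r)‖ ≤
        (∫ r in Set.Ioi (1 : ℝ), ‖v (w * r)‖) * Real.exp (-t / 2) := by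
    intro w hw hd
    rw [← MeasureTheory.integral_mul_const]
    refine MeasureTheory.norm_integral_le_of_norm_le
      (((hd.integrableOn.mono_set (Set.Ioi_subset_Ioi zero_le_one)).norm).mul_const _) ?_
    filter_upwards [MeasureTheory.ae_restrict_mem measurableSet_Ioi] with r hr
    have hr1 : (1 : ℝ) < r := hr
    rw [norm_mul, mul_comm, Complex.norm_exp]
    refine mul_le_mul_of_nonneg_left (Real.exp_le_exp.2 ?_) (norm_nonneg _)
    have : (-(w * r * t)).re = - (1 / 2 * r * t) := by
      simp [hw]
    rw [this]
    nlinarith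
  have hseg : ‖V wP - V wM‖ ≤ B * Real.sqrt 3 * Real.exp (-t / 2) := by
    have h1 := Convex.norm_image_sub_le_of_norm_hasDerivWithin_le
      (f := fun s : ℝ => V (1 / 2 + s * Complex.I))
      (f' := fun s : ℝ => Complex.exp (-((1 / 2 + s * Complex.I) * t)) * v (1 / 2 + s * Complex.I)
        * Complex.I)
      (s := Set.Icc (-(Real.sqrt 3 / 2)) (Real.sqrt 3 / 2)) (C := B * Real.exp (-t / 2))
      (x := -(Real.sqrt 3 / 2)) (y := Real.sqrt 3 / 2) ?_ ?_ (convex_Icc _ _) ?_ ?_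
    · have e1 : (1 / 2 + ((Real.sqrt 3 / 2 : ℝ) : ℂ) * Complex.I) = wP := by
        apply Complex.ext <;> simp [wP]
      have e2 : (1 / 2 + ((-(Real.sqrt 3 / 2) : ℝ) : ℂ) * Complex.I) = wM := by
        apply Complex.ext <;> simp [wM]
      simp only [e1, e2] at h1
      refine h1.trans (le_of_eq ?_)
      rw [show Real.sqrt 3 / 2 - -(Real.sqrt 3 / 2) = Real.sqrt 3 by ring,
        Real.norm_of_nonneg (Real.sqrt_nonneg 3)]
      ring
    · intro s _
      have h1 : HasDerivAt (fun s : ℝ => 1 / 2 + (s : ℂ) * Complex.I) Complex.I s := by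
        simpa using ((Complex.ofRealCLM.hasDerivAt (x := s)).mul_const Complex.I).const_add (1 / 2)
      exact ((hV _).comp s h1).hasDerivWithinAt
    · intro s hs
      rw [norm_mul, norm_mul, Complex.norm_I, mul_one, Complex.norm_exp, mul_comm]
      have e1 : (1 / 2 + (s : ℂ) * Complex.I) = ⟨1 / 2, s⟩ := by
        apply Complex.ext <;> simp
      rw [e1]
      have e2 : (-((⟨1 / 2, s⟩ : ℂ) * t)).re = -t / 2 := by
        simp; ring
      rw [e2]
      exact mul_le_mul_of_nonneg_right (hB s hs) (Real.exp_nonneg _)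
    · constructor <;> linarith [sqrt3_gt]
    · constructor <;> linarith [sqrt3_gt]
  rw [hsplit wP hp, hsplit wM hm]
  have tP := htail wP rfl hp
  have tM := htail wM rfl hm
  set IP := ∫ r in Set.Ioi (1 : ℝ), Complex.exp (-(wP * r * t)) * v (wP * r)
  set IM := ∫ r in Set.Ioi (1 : ℝ), Complex.exp (-(wM * r * t)) * v (wM * r)
  calc ‖V wP - V 0 + wP * IP - (V wM - V 0 + wM * IM)‖ = ‖(V wP - V wM) + wP * IP - wM * IM‖ := by
        congr 1; ring
    _ ≤ ‖V wP - V wM‖ + ‖wP * IP‖ + ‖wM * IM‖ :=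
        (norm_sub_le _ _).trans (add_le_add (norm_add_le _ _) le_rfl)
    _ ≤ B * Real.sqrt 3 * Real.exp (-t / 2) + ‖wP‖ * (KP * Real.exp (-t / 2))
        + ‖wM‖ * (KM * Real.exp (-t / 2)) := by
        rw [norm_mul, norm_mul]
        gcongr
    _ = _ := by ring

/-- exponentially bounded continuous functions on the half line -/
def ExpB (p : ℝ → ℂ) : Prop :=
  Continuous p ∧ ∃ A a : ℝ, ∀ r : ℝ, 0 ≤ r → ‖p r‖ ≤ A * Real.exp (a * r)

lemma ExpB.decMul {p h : ℝ → ℂ} (hp : ExpB p) (hh : Dec h) : Dec (fun r => p r * h r) :=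
  hh.mul hp.1 hp.2

lemma ExpB.mul {p q : ℝ → ℂ} (hp : ExpB p) (hq : ExpB q) : ExpB (fun r => p r * q r) := by
  obtain ⟨hc, A, a, hA⟩ := hp
  obtain ⟨qc, B, c, hB⟩ := hq
  refine ⟨hc.mul qc, A * B, a + c, fun r hr => ?_⟩
  rw [norm_mul]
  calc _ ≤ (A * Real.exp (a * r)) * (B * Real.exp (c * r)) :=
        mul_le_mul (hA r hr) (hB r hr) (norm_nonneg _) ((norm_nonneg _).trans (hA r hr))
    _ = _ := by rw [add_mul, Real.exp_add]; ring

lemma ExpB.nonneg_bound {p : ℝ → ℂ} (hp : ExpB p) : ∃ A a : ℝ, 0 ≤ A ∧ 0 ≤ a ∧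
    ∀ r : ℝ, 0 ≤ r → ‖p r‖ ≤ A * Real.exp (a * r) := by
  obtain ⟨hc, A, a, hA⟩ := hp
  refine ⟨|A|, |a|, abs_nonneg _, abs_nonneg _, fun r hr => (hA r hr).trans ?_⟩
  refine mul_le_mul (le_abs_self _) (Real.exp_le_exp.2 ?_) (Real.exp_nonneg _) (abs_nonneg _)
  exact mul_le_mul_of_nonneg_right (le_abs_self _) hr

lemma ExpB.add {p q : ℝ → ℂ} (hp : ExpB p) (hq : ExpB q) : ExpB (fun r => p r + q r) := by
  obtain ⟨A, a, hA0, ha0, hA⟩ := hp.nonneg_bound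
  obtain ⟨B, c, hB0, hc0, hB⟩ := hq.nonneg_bound
  refine ⟨hp.1.add hq.1, A + B, a + c, fun r hr => (norm_add_le _ _).trans ?_⟩
  have e1 : Real.exp (a * r) ≤ Real.exp ((a + c) * r) :=
    Real.exp_le_exp.2 (by nlinarith [mul_nonneg hc0 hr])
  have e2 : Real.exp (c * r) ≤ Real.exp ((a + c) * r) :=
    Real.exp_le_exp.2 (by nlinarith [mul_nonneg ha0 hr])
  have := mul_le_mul_of_nonneg_left e1 hA0
  have := mul_le_mul_of_nonneg_left e2 hB0
  nlinarith [hA r hr, hB r hr]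

lemma ExpB.const (k : ℂ) : ExpB (fun _ => k) :=
  ⟨continuous_const, ‖k‖, 0, fun r _ => by simp⟩

lemma ExpB.lin (k : ℂ) : ExpB (fun r => k * r) := by
  refine ⟨by fun_prop, ‖k‖, 1, fun r hr => ?_⟩
  rw [norm_mul, Complex.norm_real, Real.norm_of_nonneg hr, one_mul]
  gcongr
  linarith [Real.add_one_le_exp r]

lemma ExpB.of_tendsto {p : ℝ → ℂ} (hp : Continuous p) (ht : Tendsto p atTop (nhds 0)) : ExpB p := by
  have h1 : ∀ᶠ r in atTop, ‖p r‖ < 1 := by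
    have := ht.norm
    rw [norm_zero] at this
    exact this.eventually (gt_mem_nhds one_pos)
  obtain ⟨N, hN⟩ := eventually_atTop.1 h1
  obtain ⟨B, hB⟩ := (isCompact_Icc (a := (0 : ℝ)) (b := N)).exists_bound_of_continuousOn hp.continuousOn
  refine ⟨hp, max 1 B, 0, fun r hr => ?_⟩
  rw [zero_mul, Real.exp_zero, mul_one]
  rcases le_total N r with h | h
  · exact (hN r h).le.trans (le_max_left _ _)
  · exact (hB r ⟨hr, h⟩).trans (le_max_right _ _)

lemma ExpB.of_deriv {p q : ℝ → ℂ} (hpq : ∀ r, HasDerivAt p (q r) r) (hq : ExpB q) : ExpB p := by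
  obtain ⟨A, a, hA0, ha0, hA⟩ := hq.nonneg_bound
  refine ⟨continuous_iff_continuousAt.2 fun r => (hpq r).continuousAt, ‖p 0‖ + A, a + 1, fun r hr => ?_⟩
  have h1 := Convex.norm_image_sub_le_of_norm_hasDerivWithin_le (f := p) (f' := q)
    (s := Set.Icc 0 r) (C := A * Real.exp (a * r)) (x := 0) (y := r)
    (fun x _ => (hpq x).hasDerivWithinAt)
    (fun x hx => (hA x hx.1).trans (mul_le_mul_of_nonneg_left
      (Real.exp_le_exp.2 (mul_le_mul_of_nonneg_left hx.2 ha0)) hA0))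
    (convex_Icc _ _) ⟨le_rfl, hr⟩ ⟨hr, le_rfl⟩
  rw [sub_zero, Real.norm_of_nonneg hr] at h1
  have h2 : ‖p r‖ ≤ ‖p 0‖ + ‖p r - p 0‖ := by
    calc ‖p r‖ = ‖p 0 + (p r - p 0)‖ := by congr 1; ring
      _ ≤ _ := norm_add_le _ _
  have h3 : Real.exp ((a + 1) * r) = Real.exp (a * r) * Real.exp r := by
    rw [← Real.exp_add]; ring_nf
  have h4 : r ≤ Real.exp r := by linarith [Real.add_one_le_exp r]
  have h5 : 1 ≤ Real.exp ((a + 1) * r) := Real.one_le_exp (by positivity)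
  have h6 : A * Real.exp (a * r) * r ≤ A * Real.exp (a * r) * Real.exp r :=
    mul_le_mul_of_nonneg_left h4 (by positivity)
  have h7 := mul_le_mul_of_nonneg_left h5 (norm_nonneg (p 0))
  rw [add_mul, h3]
  rw [h3] at h7
  nlinarith

lemma ray_hasDerivAt {f : ℂ → ℂ} {f' : ℂ} (w : ℂ) (r : ℝ) (hf : HasDerivAt f f' (w * r)) :
    HasDerivAt (fun r : ℝ => f (w * r)) (f' * w) r := by
  have h1 : HasDerivAt (fun r : ℝ => w * (r : ℂ)) w r := by
    simpa using (Complex.ofRealCLM.hasDerivAt (x := r)).const_mul w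
  exact hf.comp r h1

lemma dec_E (b : ℝ) (w : ℂ) (hw : w ^ 3 = -1) :
    Dec (fun r => Complex.exp ((w * r) ^ 3 / 3 - b * (w * r))) := by
  refine ⟨by fun_prop, 1, -(b * w.re), fun r hr => ?_⟩
  rw [Complex.norm_exp, one_mul]
  apply Real.exp_le_exp.2
  rw [mul_pow, hw]
  have : ((-1 * (r : ℂ) ^ 3 / 3 - b * (w * r))) = ((-r ^ 3 / 3 : ℝ) : ℂ) - (b * r : ℝ) * w := by
    push_cast; ring
  rw [this, Complex.sub_re, Complex.ofReal_re, Complex.re_ofReal_mul]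
  linarith

/-- the auxiliary function `v = e^θ y` -/
noncomputable def vF (b : ℝ) (y : ℂ → ℂ) : ℂ → ℂ :=
  fun z => y z * Complex.exp (z ^ 3 / 3 - b * z)

lemma expB_y {y : ℂ → ℂ} (hy : Differentiable ℂ y) {w : ℂ}
    (ht : Tendsto (fun r : ℝ => y (w * r)) atTop (nhds 0)) : ExpB (fun r => y (w * r)) := by
  have := hy.continuous
  exact ExpB.of_tendsto (by fun_prop) ht

lemma expB_dy {J b : ℝ} {lam : ℂ} {y : ℂ → ℂ} (hy : Differentiable ℂ y)
    (hode : SatisfiesQuarticODE J b lam y) {w : ℂ}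
    (ht : Tendsto (fun r : ℝ => y (w * r)) atTop (nhds 0)) :
    ExpB (fun r => deriv y (w * r)) := by
  have hd : Differentiable ℂ (deriv y) := hy.deriv
  refine ExpB.of_deriv (fun r => ray_hasDerivAt w r (hd (w * r)).hasDerivAt) ?_
  have e : (fun r : ℝ => deriv (deriv y) (w * r) * w) = fun r : ℝ =>
      (((w * r) * (w * r)) * ((w * r) * (w * r)) + ((-(2 * b : ℂ)) * ((w * r) * (w * r))
        + ((2 * J : ℂ) * (w * r) + (-lam)))) * y (w * r) * w := by
    funext r
    have := hode (w * r)
    linear_combination -w * this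
  rw [e]
  have l := ExpB.lin w
  exact (((((l.mul l).mul (l.mul l)).add (((ExpB.const _).mul (l.mul l)).add
    (((ExpB.const _).mul l).add (ExpB.const _)))).mul (expB_y hy ht)).mul (ExpB.const w))

lemma ray_ode {J b : ℝ} {lam : ℂ} {y : ℂ → ℂ} (hy : Differentiable ℂ y)
    (hode : SatisfiesQuarticODE J b lam y) {w : ℂ} (hw : w ^ 3 = -1)
    (ht : Tendsto (fun r : ℝ => y (w * r)) atTop (nhds 0)) (t : ℂ) :
    2 * t * (w * LapT w (fun r => -(w * r) * (-(w * r) * vF b y (w * r))) t)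
      + 2 * (1 - J) * (w * LapT w (fun r => -(w * r) * vF b y (w * r)) t)
      - ((t + b) ^ 2 + lam) * (w * LapT w (fun r => vF b y (w * r)) t)
      = -(deriv y 0 + (t + b) * y 0) := by
  have hd : Differentiable ℂ (deriv y) := hy.deriv
  have hE := dec_E b w hw
  have hv : Dec (fun r => vF b y (w * r)) := (expB_y hy ht).decMul hE
  have l : ExpB (fun r => -(w * r)) := by
    have := ExpB.lin (-w)
    simpa using this
  have hv1 := l.decMul hv
  have hv2 := l.decMul hv1
  have i0 := (hv.mul_exp w t).integrableOn
  have i1 := (hv1.mul_exp w t).integrableOn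
  have i2 := (hv2.mul_exp w t).integrableOn
  have hF := MeasureTheory.integral_Ioi_of_hasDerivAt_of_tendsto' (a := 0) (m := 0)
    (f := fun r : ℝ => Complex.exp (-(w * r * t)) *
      ((deriv y (w * r) + (t + (b + (-1) * ((w * r) * (w * r)))) * y (w * r)) *
        Complex.exp ((w * r) ^ 3 / 3 - b * (w * r))))
    (f' := fun r : ℝ => (2 * t * w) *
      (Complex.exp (-(w * r * t)) * (-(w * r) * (-(w * r) * vF b y (w * r))))
      + (2 * (1 - J) * w) * (Complex.exp (-(w * r * t)) * (-(w * r) * vF b y (w * r)))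
      - (((t + b) ^ 2 + lam) * w) * (Complex.exp (-(w * r * t)) * vF b y (w * r))) ?_ ?_ ?_
  · rw [MeasureTheory.integral_sub, MeasureTheory.integral_add,
      MeasureTheory.integral_const_mul, MeasureTheory.integral_const_mul,
      MeasureTheory.integral_const_mul] at hF
    · simp only [LapT]
      simp at hF ⊢
      linear_combination hF
    · exact i2.const_mul _
    · exact i1.const_mul _
    · exact (i2.const_mul _).add (i1.const_mul _)
    · exact i0.const_mul _
  · intro r _
    set z : ℂ := w * r with hz
    have h1 : HasDerivAt (fun z : ℂ => Complex.exp (-(z * t)) *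
      ((deriv y z + (t + (b + (-1) * (z * z))) * y z) *
        Complex.exp (z ^ 3 / 3 - b * z))) 
        ((Complex.exp (-(z * t)) * (-t)) * ((deriv y z + (t + (b + (-1) * (z * z))) * y z) *
        Complex.exp (z ^ 3 / 3 - b * z)) + Complex.exp (-(z * t)) * (
          (deriv (deriv y) z + ((-2 * z) * y z + (t + (b + (-1) * (z * z))) * deriv y z)) * 
          Complex.exp (z ^ 3 / 3 - b * z) +
          (deriv y z + (t + (b + (-1) * (z * z))) * y z) * 
          (Complex.exp (z ^ 3 / 3 - b * z) * (z ^ 2 - b)))) z := by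
      have a1 : HasDerivAt (fun z : ℂ => -(z * t)) (-t) z := by
        have := ((hasDerivAt_id z).mul_const t).fun_neg
        simpa using this
      have a2 : HasDerivAt (fun z : ℂ => z ^ 3 / 3 - b * z) (z ^ 2 - b) z := by
        have := ((hasDerivAt_pow 3 z).div_const 3).fun_sub ((hasDerivAt_id z).const_mul (b : ℂ))
        refine this.congr_deriv ?_
        simp
      have a3 : HasDerivAt (fun z : ℂ => t + (b + (-1) * (z * z))) (-2 * z) z := by
        have := ((((hasDerivAt_id z).fun_mul (hasDerivAt_id z)).const_mul (-1)).const_add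
          (b : ℂ)).const_add t
        refine this.congr_deriv ?_
        simp
        ring
      exact a1.cexp.fun_mul (((hd z).hasDerivAt.fun_add (a3.fun_mul (hy z).hasDerivAt)).fun_mul a2.cexp)
    have h2 := ray_hasDerivAt w r h1
    refine h2.congr_deriv ?_
    have := hode z
    simp only [vF]
    linear_combination (-w * Complex.exp (-(z * t)) * Complex.exp (z ^ 3 / 3 - b * z)) * this
  · exact ((i2.const_mul _).add (i1.const_mul _)).sub (i0.const_mul _)
  · have l := ExpB.lin w
    have := (((expB_dy hy hode ht).add (((ExpB.const t).add ((ExpB.const (b : ℂ)).add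
      ((ExpB.const (-1)).mul (l.mul l)))).mul (expB_y hy ht))).decMul hE).mul_exp w t
    exact this.tendsto

/-- the contour integral `∫_γ e^{-zt} v(z) dz` -/
noncomputable def GG (v : ℂ → ℂ) (t : ℂ) : ℂ :=
  wP * LapT wP (fun r => v (wP * r)) t - wM * LapT wM (fun r => v (wM * r)) t

lemma GG_hasDerivAt {v : ℂ → ℂ} (hp : Dec (fun r => v (wP * r))) (hm : Dec (fun r => v (wM * r)))
    (t : ℂ) : HasDerivAt (GG v) (GG (fun z => -z * v z) t) t := by
  have h := ((LapT_hasDerivAt hp wP t).const_mul wP).fun_sub ((LapT_hasDerivAt hm wM t).const_mul wM)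
  refine h.congr_deriv ?_
  simp only [GG, neg_mul]

lemma wP_cube : wP ^ 3 = -1 := by
  have h := sqrt3_sq
  apply Complex.ext
  · simp [wP, pow_succ]
    nlinarith
  · simp [wP, pow_succ]
    linear_combination (-Real.sqrt 3 / 8) * h

lemma wM_cube : wM ^ 3 = -1 := by
  have h := sqrt3_sq
  apply Complex.ext
  · simp [wM, pow_succ]
    nlinarith
  · simp [wM, pow_succ]
    linear_combination (Real.sqrt 3 / 8) * h

lemma wP_eq : Complex.exp (Complex.I * (Real.pi / 3)) = wP := by
  rw [mul_comm, show ((Real.pi : ℂ) / 3) = ((Real.pi / 3 : ℝ) : ℂ) by push_cast; rfl]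
  apply Complex.ext
  · rw [Complex.exp_ofReal_mul_I_re, Real.cos_pi_div_three]; rfl
  · rw [Complex.exp_ofReal_mul_I_im, Real.sin_pi_div_three]; rfl

lemma wM_eq : Complex.exp (-Complex.I * (Real.pi / 3)) = wM := by
  rw [show -Complex.I * ((Real.pi : ℂ) / 3) = ((-(Real.pi / 3) : ℝ) : ℂ) * Complex.I by
    push_cast; ring]
  apply Complex.ext
  · rw [Complex.exp_ofReal_mul_I_re, Real.cos_neg, Real.cos_pi_div_three]; rfl
  · rw [Complex.exp_ofReal_mul_I_im, Real.sin_neg, Real.sin_pi_div_three]; rfl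

/-- The self-adjointness argument on the half line. -/
lemma half_line {J b : ℝ} (hJ : J ≤ 1) {lam : ℂ} (hlam : lam.im ≠ 0) {g g1 g2 : ℝ → ℂ}
    (h1 : ∀ t, HasDerivAt g (g1 t) t) (h2 : ∀ t, HasDerivAt g1 (g2 t) t)
    (hode : ∀ t : ℝ, 2 * t * g2 t + 2 * (1 - J) * g1 t - ((t + b) ^ 2 + lam) * g t = 0)
    (hd : ∃ K : ℝ, ∀ t : ℝ, 0 ≤ t → ‖g t‖ ≤ K * Real.exp (-t / 2))
    (hd1 : ∃ K : ℝ, ∀ t : ℝ, 0 ≤ t → ‖g1 t‖ ≤ K * Real.exp (-t / 2)) (t : ℝ) (ht : 0 < t) :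
    g t = 0 := by
  obtain ⟨K, hK⟩ := hd
  obtain ⟨K1, hK1⟩ := hd1
  have dre : ∀ {f : ℝ → ℂ} {f' : ℂ} {t : ℝ}, HasDerivAt f f' t →
      HasDerivAt (fun t => (f t).re) f'.re t := fun {f f' t} h =>
    Complex.reCLM.hasFDerivAt.comp_hasDerivAt t h
  have dim : ∀ {f : ℝ → ℂ} {f' : ℂ} {t : ℝ}, HasDerivAt f f' t →
      HasDerivAt (fun t => (f t).im) f'.im t := fun {f f' t} h =>
    Complex.imCLM.hasFDerivAt.comp_hasDerivAt t h
  set D : ℝ → ℝ := fun t => (g t).re * (g1 t).im - (g t).im * (g1 t).re with hD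
  set W : ℝ → ℝ := fun t => lam.im * (t ^ (1 - J) * D t) with hW
  have hDd : ∀ t, HasDerivAt D ((g t).re * (g2 t).im - (g t).im * (g2 t).re) t := by
    intro t
    have := ((dre (h1 t)).fun_mul (dim (h2 t))).fun_sub ((dim (h1 t)).fun_mul (dre (h2 t)))
    exact this.congr_deriv (by ring)
  have hWd : ∀ t, 0 < t → HasDerivAt W
      (t ^ (-J) * (lam.im ^ 2 * ((g t).re ^ 2 + (g t).im ^ 2)) / 2) t := by
    intro t ht
    have hp := Real.hasDerivAt_rpow_const (x := t) (p := 1 - J) (Or.inl ht.ne')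
    have := (hp.fun_mul (hDd t)).const_mul lam.im
    refine this.congr_deriv ?_
    have e1 : t ^ (1 - J - 1) = t ^ (-J) := by ring_nf
    have e2 : t ^ (1 - J) = t * t ^ (-J) := by
      rw [sub_eq_add_neg, Real.rpow_add ht, Real.rpow_one]
    rw [e1, e2]
    have o := hode t
    have o1 := congrArg Complex.re o
    have o2 := congrArg Complex.im o
    have p1 : (((t : ℂ) + b) ^ 2).re = (t + b) ^ 2 := by
      rw [← Complex.ofReal_add, ← Complex.ofReal_pow, Complex.ofReal_re]
    have p2 : (((t : ℂ) + b) ^ 2).im = 0 := by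
      rw [← Complex.ofReal_add, ← Complex.ofReal_pow, Complex.ofReal_im]
    simp [p1, p2] at o1 o2
    simp only [hD]
    linear_combination (t ^ (-J) * lam.im * (g t).re / 2) * o2
      - (t ^ (-J) * lam.im * (g t).im / 2) * o1
  have hW0 : W 0 = 0 := by
    rcases hJ.lt_or_eq with h | h
    · simp [hW, Real.zero_rpow (by linarith : 1 - J ≠ 0)]
    · have o := hode 0
      subst h
      have : (b : ℂ) ^ 2 + lam ≠ 0 := by
        intro hc
        have := congrArg Complex.im hc
        rw [← Complex.ofReal_pow, Complex.add_im, Complex.ofReal_im] at this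
        simp at this
        exact hlam this
      simp at o
      rcases o with o | o
      · exact absurd o this
      · simp [hW, hD, o]
  have hcont : ContinuousOn W (Set.Ici 0) := by
    have c1 : Continuous D := continuous_iff_continuousAt.2 fun t => (hDd t).continuousAt
    have c2 : Continuous fun t : ℝ => t ^ (1 - J) := Real.continuous_rpow_const (by linarith)
    exact (continuous_const.mul (c2.mul c1)).continuousOn
  have hmono : MonotoneOn W (Set.Ici 0) := by
    apply monotoneOn_of_deriv_nonneg (convex_Ici 0) hcont
    · intro x hx
      rw [interior_Ici] at hx
      exact (hWd x hx).differentiableAt.differentiableWithinAt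
    · intro x hx
      rw [interior_Ici] at hx
      rw [(hWd x hx).deriv]
      have := Real.rpow_nonneg (le_of_lt hx) (-J)
      positivity
  have hlim : Tendsto W atTop (nhds 0) := by
    have e := (tendsto_rpow_mul_exp_neg_mul_atTop_nhds_zero (1 - J) 1 one_pos).const_mul
      (|lam.im| * (2 * (K * K1)))
    rw [mul_zero] at e
    refine squeeze_zero_norm' ?_ e
    filter_upwards [eventually_ge_atTop 0] with x hx
    have hDx : |D x| ≤ 2 * (‖g x‖ * ‖g1 x‖) := by
      have q1 := mul_le_mul (Complex.abs_re_le_norm (g x)) (Complex.abs_im_le_norm (g1 x))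
        (abs_nonneg _) (norm_nonneg _)
      have q2 := mul_le_mul (Complex.abs_im_le_norm (g x)) (Complex.abs_re_le_norm (g1 x))
        (abs_nonneg _) (norm_nonneg _)
      rw [← abs_mul] at q1 q2
      simp only [hD]
      have := abs_sub ((g x).re * (g1 x).im) ((g x).im * (g1 x).re)
      linarith
    have q := mul_le_mul (hK x hx) (hK1 x hx) (norm_nonneg _) ((norm_nonneg _).trans (hK x hx))
    have q' : K * Real.exp (-x / 2) * (K1 * Real.exp (-x / 2)) = K * K1 * Real.exp (-1 * x) := by
      have : Real.exp (-1 * x) = Real.exp (-x / 2) * Real.exp (-x / 2) := by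
        rw [← Real.exp_add]; ring_nf
      rw [this]; ring
    rw [q'] at q
    have hxp := Real.rpow_nonneg hx (1 - J)
    rw [Real.norm_eq_abs]
    simp only [hW]
    rw [abs_mul, abs_mul, abs_of_nonneg hxp]
    calc |lam.im| * (x ^ (1 - J) * |D x|)
        ≤ |lam.im| * (x ^ (1 - J) * (2 * (K * K1 * Real.exp (-1 * x)))) := by
          gcongr
          linarith
      _ = _ := by ring
  have hzero : ∀ x, 0 < x → W x = 0 := by
    intro x hx
    apply le_antisymm
    · refine ge_of_tendsto hlim ?_
      filter_upwards [eventually_ge_atTop x] with s hs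
      exact hmono hx.le (hx.le.trans hs) hs
    · rw [← hW0]
      exact hmono (Set.mem_Ici.2 le_rfl) hx.le hx.le
  have hder : HasDerivAt W 0 t := by
    refine (hasDerivAt_const t (0 : ℝ)).congr_of_eventuallyEq ?_
    filter_upwards [Ioi_mem_nhds ht] with x hx
    exact hzero x hx
  have hu := hder.unique (hWd t ht)
  have hp := Real.rpow_pos_of_pos ht (-J)
  have hl : 0 < lam.im ^ 2 := by positivity
  have hs : (g t).re ^ 2 + (g t).im ^ 2 = 0 := by
    have : t ^ (-J) * (lam.im ^ 2 * ((g t).re ^ 2 + (g t).im ^ 2)) = 0 := by linarith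
    rcases mul_eq_zero.1 this with h | h
    · exact absurd h hp.ne'
    · rcases mul_eq_zero.1 h with h | h
      · exact absurd h hl.ne'
      · exact h
  apply Complex.ext
  · simp; nlinarith [sq_nonneg (g t).re, sq_nonneg (g t).im]
  · simp; nlinarith [sq_nonneg (g t).re, sq_nonneg (g t).im]

theorem eigenvalues_real_of_J_le_one (J : ℝ) (hJ : J ≤ 1) (b : ℝ) (lam : ℂ)
    (hev : IsQuarticEigenvalue (J : ℂ) (b : ℂ) lam) :
    lam.im = 0 := by
  by_contra hlam
  obtain ⟨y, hy, hne, hode, htP, htM⟩ := hev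
  rw [wP_eq] at htP
  rw [wM_eq] at htM
  simp only [mul_comm _ wP] at htP
  simp only [mul_comm _ wM] at htM
  have hvd : Differentiable ℂ (vF b y) := by
    unfold vF
    fun_prop
  have neg_lin : ∀ w : ℂ, ExpB (fun r => -(w * r)) := fun w => by simpa using ExpB.lin (-w)
  have hP : Dec (fun r => vF b y (wP * r)) := (expB_y hy htP).decMul (dec_E b wP wP_cube)
  have hM : Dec (fun r => vF b y (wM * r)) := (expB_y hy htM).decMul (dec_E b wM wM_cube)
  have hP1 := (neg_lin wP).decMul hP
  have hM1 := (neg_lin wM).decMul hM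
  have hzero : ∀ t : ℝ, 0 < t → GG (vF b y) t = 0 := by
    refine half_line (J := J) (b := b) hJ hlam (g := fun t : ℝ => GG (vF b y) t)
      (g1 := fun t : ℝ => GG (fun z => -z * vF b y z) t)
      (g2 := fun t : ℝ => GG (fun z => -z * (-z * vF b y z)) t) ?_ ?_ ?_ ?_ ?_
    · intro t
      exact (GG_hasDerivAt hP hM t).comp_ofReal
    · intro t
      exact (GG_hasDerivAt (v := fun z => -z * vF b y z) hP1 hM1 t).comp_ofReal
    · intro t
      have rP := ray_ode hy hode wP_cube htP t
      have rM := ray_ode hy hode wM_cube htM t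
      simp only [GG]
      linear_combination rP - rM
    · exact contour_decay hvd hP hM
    · exact contour_decay (v := fun z => -z * vF b y z) (by fun_prop) hP1 hM1
  have hdiff : Differentiable ℂ (GG (vF b y)) := fun t => (GG_hasDerivAt hP hM t).differentiableAt
  have hall : GG (vF b y) = fun _ => 0 := by
    refine AnalyticOnNhd.eq_of_frequently_eq (z₀ := 1)
      (fun z _ => hdiff.analyticAt z) (fun z _ => analyticAt_const) ?_
    have hseq : Tendsto (fun x : ℝ => (x : ℂ)) (nhdsWithin 1 {1}ᶜ) (nhdsWithin 1 {1}ᶜ) := by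
      refine tendsto_nhdsWithin_iff.2 ⟨?_, ?_⟩
      · have := Complex.continuous_ofReal.tendsto 1
        rw [Complex.ofReal_one] at this
        exact this.mono_left nhdsWithin_le_nhds
      · filter_upwards [self_mem_nhdsWithin] with x hx
        simpa using hx
    refine hseq.frequently (Eventually.frequently ?_)
    filter_upwards [nhdsWithin_le_nhds (Ioi_mem_nhds (zero_lt_one' ℝ))] with x hx
    exact hzero x hx
  have hv0 : ∀ r : ℝ, 0 < r → wP * vF b y (wP * r) = 0 := by
    refine rays_zero (hP.const_mul wP) (hM.const_mul wM) ?_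
    intro t
    have h := congrFun hall t
    simp only [GG, LapT, ← MeasureTheory.integral_const_mul] at h
    rw [sub_eq_zero] at h
    simp only [LapT]
    simp only [mul_left_comm _ wP, mul_left_comm _ wM]
    exact h
  apply hne
  refine AnalyticOnNhd.eq_of_frequently_eq (z₀ := wP)
      (fun z _ => hy.analyticAt z) (fun z _ => analyticAt_const) ?_
  have hseq : Tendsto (fun x : ℝ => wP * (x : ℂ)) (nhdsWithin 1 {1}ᶜ) (nhdsWithin wP {wP}ᶜ) := by
    refine tendsto_nhdsWithin_iff.2 ⟨?_, ?_⟩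
    · have h : Continuous (fun x : ℝ => wP * (x : ℂ)) := by fun_prop
      have := h.tendsto 1
      rw [Complex.ofReal_one, mul_one] at this
      exact this.mono_left nhdsWithin_le_nhds
    · filter_upwards [self_mem_nhdsWithin] with x hx
      simpa [wP_ne] using hx
  refine hseq.frequently (Eventually.frequently ?_)
  filter_upwards [nhdsWithin_le_nhds (Ioi_mem_nhds (zero_lt_one' ℝ))] with x hx
  have h := hv0 x hx
  simpa [wP_ne, vF] using h
end
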